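/- arXiv:1402.7322 — 11 statements merged into one kernel-verified Lean document; each statement's English description precedes it below -/
import Mathlib

section
/- For every unweighted network H on V, all vertices i, j ∈ V with i ≠ j, and every n ≥ 0, the partial sum e_ij^(n) of path weights satisfies e_ij^(n) ≤ 1. -/
/-- A path from `i` to `j` along the edge relation `E` on `Fin p`:
it is recorded as the nonempty list of vertices `[p₁, …, pₘ]` following the
(implicit) start vertex `p₀ = i`, with `m ≥ 1`, consecutive edges
`E p_{k-1} p_k`, final vertex `pₘ = j`, and `p_k ≠ i` for all `k ≥ 1`. -/
structure NetPath {p : ℕ} (E : Fin p → Fin p → Prop) (i j : Fin p) : Type where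
  steps : List (Fin p)
  ne : steps ≠ []
  chain : List.Chain E i steps
  last : steps.getLast ne = j
  avoid : ∀ v ∈ steps, v ≠ i

/-- The edge relation of a binary (unweighted) network `H`. -/
def edge {p : ℕ} (H : Fin p → Fin p → Bool) : Fin p → Fin p → Prop :=
  fun u v => H u v = true

/-- The set `H(•,j)` of parents of vertex `j` in the unweighted network `H`. -/
def parents {p : ℕ} (H : Fin p → Fin p → Bool) (j : Fin p) : Finset (Fin p) :=
  Finset.univ.filter fun k => H k j = true

/-- The length `ℓ(P)` of a path. -/
def plen {p : ℕ} {E : Fin p → Fin p → Prop} {i j : Fin p} (P : NetPath E i j) : ℕ :=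
  P.steps.length

/-- The weight `w(P) = ∏_{k=1}^{m} 1/|H(•,p_k)|` of a path. -/
noncomputable def pweight {p : ℕ} (H : Fin p → Fin p → Bool) {i j : Fin p}
    (P : NetPath (edge H) i j) : ℝ :=
  (P.steps.map fun v => (1 : ℝ) / ((parents H v).card : ℝ)).prod

/-- The partial sum `e_ij^(n)`: the sum of `w(P)` over paths `P ∈ H(i→j)` with `ℓ(P) ≤ n`. -/
noncomputable def psum {p : ℕ} (H : Fin p → Fin p → Bool) (i j : Fin p) (n : ℕ) : ℝ :=
  ∑' P : {P : NetPath (edge H) i j // plen P ≤ n}, pweight H P.val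

/-- The step lists of walks of length at most `n` from `i` to `v` which leave `i` for good. -/
def walks {p : ℕ} (H : Fin p → Fin p → Bool) (i : Fin p) : ℕ → Fin p → Finset (List (Fin p))
  | 0, v => if v = i then {[]} else ∅
  | n + 1, v => if v = i then {[]} else
      (parents H v).biUnion fun u => (walks H i n u).image fun l => l ++ [v]

/-- Weight of a step list. -/
noncomputable def wt {p : ℕ} (H : Fin p → Fin p → Bool) (l : List (Fin p)) : ℝ :=
  (l.map fun v => (1 : ℝ) / ((parents H v).card : ℝ)).prod

lemma wt_nonneg {p : ℕ} (H : Fin p → Fin p → Bool) (l : List (Fin p)) : 0 ≤ wt H l := by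
  apply List.prod_nonneg
  intro a ha
  obtain ⟨v, _, rfl⟩ := List.mem_map.1 ha
  positivity

lemma sum_biUnion_le_sum {α β : Type*} [DecidableEq α] [DecidableEq β] (s : Finset α)
    (t : α → Finset β) (f : β → ℝ) (hf : ∀ b, 0 ≤ f b) :
    ∑ b ∈ s.biUnion t, f b ≤ ∑ a ∈ s, ∑ b ∈ t a, f b := by
  induction s using Finset.induction_on with
  | empty => simp
  | insert a s ha ih =>
    rw [Finset.biUnion_insert, Finset.sum_insert ha]
    have h := Finset.sum_union_inter (s₁ := t a) (s₂ := s.biUnion t) (f := f)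
    have h' : 0 ≤ ∑ b ∈ t a ∩ s.biUnion t, f b := Finset.sum_nonneg fun b _ => hf b
    linarith

lemma sum_walks_le {p : ℕ} (H : Fin p → Fin p → Bool) (i : Fin p) (n : ℕ) :
    ∀ v, ∑ l ∈ walks H i n v, wt H l ≤ 1 := by
  induction n with
  | zero =>
    intro v
    by_cases h : v = i <;> simp [walks, h, wt]
  | succ n ih =>
    intro v
    by_cases h : v = i
    · simp [walks, h, wt]
    · have hinj : Function.Injective (fun l : List (Fin p) => l ++ [v]) :=
        List.append_left_injective [v]
      have hdisj : ∑ l ∈ walks H i (n + 1) v, wt H l ≤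
          ∑ u ∈ parents H v, ∑ l ∈ (walks H i n u).image (fun l => l ++ [v]), wt H l := by
        simp only [walks, h, if_false]
        exact sum_biUnion_le_sum _ _ _ (wt_nonneg H)
      refine hdisj.trans ?_
      calc _ = ∑ u ∈ parents H v, (∑ l ∈ walks H i n u, wt H l) * (1 / ((parents H v).card : ℝ)) := by
            refine Finset.sum_congr rfl fun u _ => ?_
            rw [Finset.sum_image hinj.injOn, Finset.sum_mul]
            simp [wt]
        _ ≤ ∑ u ∈ parents H v, 1 * (1 / ((parents H v).card : ℝ)) := by
            gcongr with u _
            exact ih u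
        _ ≤ 1 := by
            rw [Finset.sum_const, nsmul_eq_mul, one_mul, mul_one_div]
            exact div_self_le_one _

lemma mem_walks {p : ℕ} (H : Fin p → Fin p → Bool) (i : Fin p) (n : ℕ) :
    ∀ l : List (Fin p), l.length ≤ n → List.IsChain (edge H) (i :: l) → (∀ v ∈ l, v ≠ i) →
      l ∈ walks H i n ((i :: l).getLast (List.cons_ne_nil _ _)) := by
  induction n with
  | zero =>
    intro l hl _ _
    have : l = [] := by simpa using hl
    subst this
    simp [walks]
  | succ n ih =>
    intro l hl hc ha
    rcases List.eq_nil_or_concat l with rfl | ⟨l', x, rfl⟩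
    · simp [walks]
    · have hx : x ≠ i := ha x (by simp)
      have hc' : List.IsChain (edge H) ((i :: l') ++ [x]) := by simpa using hc
      rw [List.isChain_append] at hc'
      obtain ⟨h1, _, h2⟩ := hc'
      have h3 := h2 _ (List.getLast?_eq_getLast_of_ne_nil (List.cons_ne_nil i l')) x (by simp)
      have h4 := ih l' (by simpa using hl) h1 (fun v hv => ha v (by simp [hv]))
      have : (i :: (l' ++ [x])).getLast (List.cons_ne_nil _ _) = x := by simp
      simp only [List.concat_eq_append, this]
      simp only [walks, hx, if_false, Finset.mem_biUnion, Finset.mem_image]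
      exact ⟨_, by simpa [parents, edge] using h3, l', h4, rfl⟩

theorem partial_sum_le_one (p : ℕ) (hp : 2 ≤ p) (H : Fin p → Fin p → Bool)
    (hdiag : ∀ i : Fin p, H i i = false) (i j : Fin p) (hij : i ≠ j) (n : ℕ) :
    psum H i j n ≤ 1 := by
  classical
  unfold psum
  refine tsum_le_of_sum_le' zero_le_one fun s => ?_
  have hinj : Function.Injective
      (fun P : {P : NetPath (edge H) i j // plen P ≤ n} => P.val.steps) := by
    rintro ⟨⟨a, _, _, _, _⟩, _⟩ ⟨⟨b, _, _, _, _⟩, _⟩ h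
    simpa using h
  calc ∑ P ∈ s, pweight H P.val
      = ∑ l ∈ s.image (fun P => P.val.steps), wt H l := by
        rw [Finset.sum_image hinj.injOn]
        rfl
    _ ≤ ∑ l ∈ walks H i n j, wt H l := by
        refine Finset.sum_le_sum_of_subset_of_nonneg ?_ fun l _ _ => wt_nonneg H l
        intro l hl
        obtain ⟨P, _, rfl⟩ := Finset.mem_image.1 hl
        have h := mem_walks H i n P.val.steps P.2 P.val.chain P.val.avoid
        rwa [List.getLast_cons P.val.ne, P.val.last] at h
    _ ≤ 1 := sum_walks_le H i n j
end

section
/- For every unweighted network H on V and all vertices i, j ∈ V, the family of path weights {w(P) : P ∈ H(i→j)} is summable; consequently the effect e_ij = δ_ij + Σ_{P ∈ H(i→j)} w(P) is well-defined and satisfies 0 ≤ e_ij ≤ 1. -/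
/-- The effect `e_ij = δ_ij + Σ_{P ∈ H(i→j)} w(P)` (unordered sum). -/
noncomputable def effect {p : ℕ} (H : Fin p → Fin p → Bool) (i j : Fin p) : ℝ :=
  (if i = j then (1 : ℝ) else 0) + ∑' P : NetPath (edge H) i j, pweight H P

/-- Reversed paths, including the trivial one, read backwards from the end vertex to `i`. -/
inductive GoodPath {p : ℕ} (H : Fin p → Fin p → Bool) (i : Fin p) :
    Fin p → List (Fin p) → Prop
  | nil : GoodPath H i i []
  | cons (k v : Fin p) (l : List (Fin p)) : v ≠ i → H k v = true → GoodPath H i k l →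
      GoodPath H i v (v :: l)

/-- The weight of a list of vertices. -/
noncomputable def listWeight {p : ℕ} (H : Fin p → Fin p → Bool) (l : List (Fin p)) : ℝ :=
  (l.map fun v => (1 : ℝ) / ((parents H v).card : ℝ)).prod

lemma listWeight_cons {p : ℕ} (H : Fin p → Fin p → Bool) (v : Fin p) (l : List (Fin p)) :
    listWeight H (v :: l) = (1 : ℝ) / ((parents H v).card : ℝ) * listWeight H l := by
  simp [listWeight]

lemma GoodPath.headD_eq {p : ℕ} {H : Fin p → Fin p → Bool} {i v : Fin p} {l : List (Fin p)}
    (h : GoodPath H i v l) : l.headD i = v := by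
  cases h <;> simp

lemma GoodPath.cons_inv {p : ℕ} {H : Fin p → Fin p → Bool} {i v : Fin p} (hv : v ≠ i)
    {l : List (Fin p)} (h : GoodPath H i v l) :
    l = v :: l.tail ∧ l.tail.headD i ∈ parents H v ∧ GoodPath H i (l.tail.headD i) l.tail := by
  cases h with
  | nil => exact absurd rfl hv
  | cons k _ l h1 h2 h3 =>
    have := h3.headD_eq
    simp only [List.tail_cons, this]
    exact ⟨trivial, by simp [parents, h2], h3⟩

lemma sum_good_le {p : ℕ} (H : Fin p → Fin p → Bool) (i : Fin p) (n : ℕ) :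
    ∀ (v : Fin p) (S : Finset (List (Fin p))),
      (∀ l ∈ S, GoodPath H i v l ∧ l.length ≤ n) → ∑ l ∈ S, listWeight H l ≤ 1 := by
  classical
  have base : ∀ S : Finset (List (Fin p)), (∀ l ∈ S, l = []) →
      ∑ l ∈ S, listWeight H l ≤ 1 := by
    intro S hS
    have : S ⊆ {[]} := fun l hl => by simp [hS l hl]
    rcases Finset.subset_singleton_iff.1 this with h | h <;> simp [h, listWeight]
  induction n with
  | zero =>
    intro v S hS
    exact base S fun l hl => List.length_eq_zero_iff.1 (Nat.le_zero.1 (hS l hl).2)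
  | succ n ih =>
    intro v S hS
    by_cases hv : v = i
    · refine base S fun l hl => ?_
      have h := (hS l hl).1
      cases h with
      | nil => rfl
      | cons k _ l h1 h2 h3 => exact absurd hv h1
    have h1 : ∑ l ∈ S, listWeight H l
        = ∑ l ∈ S, (1 : ℝ) / ((parents H v).card : ℝ) * listWeight H l.tail := by
      refine Finset.sum_congr rfl fun l hl => ?_
      rw [← listWeight_cons, ← ((hS l hl).1.cons_inv hv).1]
    have h2 : ∑ l ∈ S, listWeight H l.tail
        = ∑ k ∈ parents H v, ∑ l ∈ S with l.tail.headD i = k, listWeight H l.tail :=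
      (Finset.sum_fiberwise_of_maps_to
        (fun l hl => ((hS l hl).1.cons_inv hv).2.1) _).symm
    have h3 : ∀ k ∈ parents H v,
        ∑ l ∈ S with l.tail.headD i = k, listWeight H l.tail ≤ 1 := by
      intro k _
      rw [← Finset.sum_image (s := S.filter fun l => l.tail.headD i = k)
        (g := List.tail) (f := listWeight H)]
      · apply ih k
        intro l hl
        obtain ⟨m, hm, rfl⟩ := Finset.mem_image.1 hl
        obtain ⟨hmS, rfl⟩ := Finset.mem_filter.1 hm
        refine ⟨((hS m hmS).1.cons_inv hv).2.2, ?_⟩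
        have := (hS m hmS).2
        rw [List.length_tail]
        omega
      · intro a ha b hb hab
        have ha' := ((hS a (Finset.mem_filter.1 ha).1).1.cons_inv hv).1
        have hb' := ((hS b (Finset.mem_filter.1 hb).1).1.cons_inv hv).1
        rw [ha', hb', hab]
    have h4 : ∑ l ∈ S, listWeight H l.tail ≤ ((parents H v).card : ℝ) := by
      rw [h2]
      calc _ ≤ ∑ k ∈ parents H v, (1 : ℝ) := Finset.sum_le_sum h3
        _ = _ := by simp
    rw [h1, ← Finset.mul_sum]
    calc _ ≤ (1 : ℝ) / ((parents H v).card : ℝ) * ((parents H v).card : ℝ) :=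
          mul_le_mul_of_nonneg_left h4 (by positivity)
      _ ≤ 1 := by
          rw [one_div]
          exact inv_mul_le_one

lemma goodPath_of_chain {p : ℕ} (H : Fin p → Fin p → Bool) (i : Fin p) (l : List (Fin p)) :
    List.IsChain (edge H) (i :: l) → (∀ v ∈ l, v ≠ i) →
      GoodPath H i ((i :: l).getLast (List.cons_ne_nil _ _)) l.reverse := by
  induction l using List.reverseRecOn with
  | nil => intro _ _; exact GoodPath.nil
  | append_singleton l v ih =>
    intro hc ha
    rw [← List.cons_append, List.isChain_append] at hc
    obtain ⟨hc1, _, hc2⟩ := hc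
    have h := ih hc1 fun w hw => ha w (by simp [hw])
    have e := hc2 _ (List.getLast_mem_getLast? (List.cons_ne_nil i l)) v (by simp)
    have := GoodPath.cons _ v _ (ha v (by simp)) e h
    simpa using this

lemma NetPath.steps_injective {p : ℕ} {E : Fin p → Fin p → Prop} {i j : Fin p} :
    Function.Injective (NetPath.steps : NetPath E i j → List (Fin p)) := by
  rintro ⟨a, _, _, _, _⟩ ⟨b, _, _, _, _⟩ h
  cases h
  rfl

lemma sum_pweight_le {p : ℕ} (H : Fin p → Fin p → Bool) (i j : Fin p)
    (S : Finset (NetPath (edge H) i j)) : ∑ P ∈ S, pweight H P ≤ 1 := by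
  classical
  have hw : ∀ P ∈ S, pweight H P = listWeight H P.steps.reverse := by
    intro P _
    rw [pweight, listWeight, List.map_reverse, List.prod_reverse]
  rw [Finset.sum_congr rfl hw, ← Finset.sum_image (s := S)
    (g := fun P : NetPath (edge H) i j => P.steps.reverse) (f := listWeight H)]
  · refine sum_good_le H i (S.sup fun P => P.steps.length) j _ fun l hl => ?_
    obtain ⟨P, hP, rfl⟩ := Finset.mem_image.1 hl
    constructor
    · have := goodPath_of_chain H i P.steps P.chain P.avoid
      rwa [List.getLast_cons P.ne, P.last] at this
    · rw [List.length_reverse]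
      exact Finset.le_sup (f := fun P : NetPath (edge H) i j => P.steps.length) hP
  · intro a _ b _ hab
    exact NetPath.steps_injective (List.reverse_injective hab)

lemma pweight_nonneg {p : ℕ} (H : Fin p → Fin p → Bool) {i j : Fin p}
    (P : NetPath (edge H) i j) : 0 ≤ pweight H P := by
  apply List.prod_nonneg
  intro a ha
  obtain ⟨v, _, rfl⟩ := List.mem_map.1 ha
  positivity

theorem effect_well_defined (p : ℕ) (hp : 2 ≤ p) (H : Fin p → Fin p → Bool)
    (hdiag : ∀ i : Fin p, H i i = false) (i j : Fin p) :
    Summable (fun P : NetPath (edge H) i j => pweight H P) ∧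
      0 ≤ effect H i j ∧ effect H i j ≤ 1 := by
  have hs : Summable (fun P : NetPath (edge H) i j => pweight H P) :=
    summable_of_sum_le (fun P => pweight_nonneg H P) (sum_pweight_le H i j)
  refine ⟨hs, ?_, ?_⟩
  · refine add_nonneg (by split_ifs <;> norm_num) (tsum_nonneg fun P => pweight_nonneg H P)
  · unfold effect
    split_ifs with h
    · have : IsEmpty (NetPath (edge H) i j) :=
        ⟨fun P => P.avoid _ (List.getLast_mem P.ne) (P.last.trans h.symm)⟩
      simp
    · rw [zero_add]
      exact hs.tsum_le_of_sum_le (sum_pweight_le H i j)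
end

section
/- For every unweighted network H on V and all vertices i, j ∈ V: if H(i→j) ≠ ∅ (there is at least one path from i to j), then the effects satisfy the recursion e_ij = (1/|H(•,j)|) · Σ_{k ∈ H(•,j)} e_ik. -/
open scoped ENNReal

/-- Weight of the reversed step list, defined by recursion on the last step. -/
noncomputable def revW {p : ℕ} (H : Fin p → Fin p → Bool) (i : Fin p) :
    List (Fin p) → Fin p → ℝ≥0∞
  | [], j => if i = j then 1 else 0
  | v :: r, j => if v = j ∧ j ≠ i then
      ((parents H j).card : ℝ≥0∞)⁻¹ * ∑ k ∈ parents H j, revW H i r k else 0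

/-- `l` is the list of steps of a possibly trivial path from `i` to `j`. -/
def GoodP {p : ℕ} (H : Fin p → Fin p → Bool) (i j : Fin p) (l : List (Fin p)) : Prop :=
  List.IsChain (edge H) (i :: l) ∧ (i :: l).getLast (by simp) = j ∧ ∀ v ∈ l, v ≠ i

theorem goodP_concat {p : ℕ} (H : Fin p → Fin p → Bool) (i j v : Fin p) (l : List (Fin p)) :
    GoodP H i j (l ++ [v]) ↔
      (v = j ∧ j ≠ i) ∧ (i :: l).getLast (by simp) ∈ parents H j ∧
        GoodP H i ((i :: l).getLast (by simp)) l := by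
  have e : i :: (l ++ [v]) = (i :: l) ++ [v] := rfl
  unfold GoodP
  simp only [e, List.isChain_append, List.getLast_append]
  simp only [List.getLast?_eq_getLast_of_ne_nil (List.cons_ne_nil i l)]
  simp [parents, edge]
  constructor
  · rintro ⟨⟨h1, h2⟩, rfl, h3⟩
    exact ⟨⟨rfl, h3 v (Or.inr rfl)⟩, h2, h1, fun w hw => h3 w (Or.inl hw)⟩
  · rintro ⟨⟨rfl, h3⟩, h2, h1, h4⟩
    refine ⟨⟨h1, h2⟩, rfl, ?_⟩
    rintro w (hw | rfl)
    · exact h4 w hw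
    · exact h3

open Classical in
theorem revW_eq {p : ℕ} (H : Fin p → Fin p → Bool) (i : Fin p) (r : List (Fin p)) :
    ∀ j, revW H i r j = if GoodP H i j r.reverse then
      (r.map fun v => ((parents H v).card : ℝ≥0∞)⁻¹).prod else 0 := by
  induction r with
  | nil => intro j; simp [revW, GoodP]
  | cons v r ih =>
    intro j
    rw [List.reverse_cons, goodP_concat, revW]
    by_cases hv : v = j ∧ j ≠ i
    · obtain ⟨rfl, hj⟩ := hv
      simp only [ih]
      set k0 := (i :: r.reverse).getLast (by simp) with hk0
      have hs : ∀ k ∈ parents H v, k ≠ k0 → (if GoodP H i k r.reverse then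
          (r.map fun v => ((parents H v).card : ℝ≥0∞)⁻¹).prod else 0) = 0 := by
        intro k _ hk
        rw [if_neg]
        rintro ⟨_, h2, _⟩
        exact hk (h2.symm)
      by_cases hm : k0 ∈ parents H v
      · rw [Finset.sum_eq_single_of_mem k0 hm hs]
        simp [hj, hm]
      · rw [Finset.sum_eq_zero]
        · simp [hm]
        · intro k hk
          exact hs k hk (by rintro rfl; exact hm hk)
    · simp [hv]

theorem tsum_revW_self {p : ℕ} (H : Fin p → Fin p → Bool) (i : Fin p)
    (φ : List (Fin p) → ℝ≥0∞) : ∑' r, revW H i r i * φ r = φ [] := by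
  rw [tsum_eq_single []]
  · simp [revW]
  · rintro (_ | ⟨v, r⟩) h
    · exact absurd rfl h
    · simp [revW]

theorem tsum_revW_ne {p : ℕ} (H : Fin p → Fin p → Bool) (i j : Fin p) (hij : i ≠ j)
    (φ : List (Fin p) → ℝ≥0∞) : ∑' r, revW H i r j * φ r =
      ((parents H j).card : ℝ≥0∞)⁻¹ *
        ∑ k ∈ parents H j, ∑' r, revW H i r k * φ (j :: r) := by
  have hinj : Function.Injective (fun r : List (Fin p) => j :: r) :=
    fun a b h => (List.cons.inj h).2
  rw [← hinj.tsum_eq]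
  · simp only [revW]
    rw [← Summable.tsum_finsetSum (fun _ _ => ENNReal.summable), ← ENNReal.tsum_mul_left]
    refine tsum_congr fun r => ?_
    rw [if_pos (by simpa using hij.symm), mul_assoc, Finset.sum_mul]
  · rintro (_ | ⟨v, r⟩) h
    · simp [revW, hij] at h
    · by_cases hv : v = j
      · subst hv; exact ⟨r, rfl⟩
      · simp [revW, hv] at h

theorem trunc_le {p : ℕ} (H : Fin p → Fin p → Bool) (i : Fin p) (n : ℕ) :
    ∀ j, ∑' r, revW H i r j * (if r.length < n then 1 else 0) ≤ 1 := by
  induction n with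
  | zero => intro j; simp
  | succ n ih =>
    intro j
    by_cases hij : i = j
    · subst hij
      rw [tsum_revW_self]; simp
    · rw [tsum_revW_ne H i j hij]
      simp only [List.length_cons, Nat.add_lt_add_iff_right]
      calc _ ≤ ((parents H j).card : ℝ≥0∞)⁻¹ * ∑ k ∈ parents H j, 1 := by
            gcongr with k hk
            exact ih k
        _ ≤ 1 := by
            simp only [Finset.sum_const, nsmul_eq_mul, mul_one]
            exact ENNReal.inv_mul_le_one _

theorem tsum_revW_le {p : ℕ} (H : Fin p → Fin p → Bool) (i j : Fin p) :
    ∑' r, revW H i r j ≤ 1 := by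
  rw [ENNReal.tsum_eq_iSup_sum]
  refine iSup_le fun s => ?_
  refine le_trans ?_ (trunc_le H i (s.sup List.length + 1) j)
  refine le_trans ?_ (ENNReal.sum_le_tsum s)
  refine Finset.sum_le_sum fun r hr => ?_
  rw [if_pos (Nat.lt_succ_of_le (Finset.le_sup (f := List.length) hr)), mul_one]

theorem netPath_good {p : ℕ} (H : Fin p → Fin p → Bool) {i j : Fin p}
    (P : NetPath (edge H) i j) : GoodP H i j P.steps := by
  refine ⟨P.chain, ?_, P.avoid⟩
  rw [List.getLast_cons P.ne]
  exact P.last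

theorem netPath_ne {p : ℕ} {E : Fin p → Fin p → Prop} {i j : Fin p}
    (P : NetPath E i j) : i ≠ j := by
  have := P.avoid _ (List.getLast_mem P.ne)
  rw [P.last] at this
  exact this.symm

theorem effect_eq {p : ℕ} (H : Fin p → Fin p → Bool) (i j : Fin p) :
    effect H i j = (∑' r, revW H i r j).toReal := by
  unfold effect
  by_cases hij : i = j
  · subst hij
    haveI : IsEmpty (NetPath (edge H) i i) := ⟨fun P => netPath_ne P rfl⟩
    have := tsum_revW_self H i (fun _ => 1)
    simp only [mul_one] at this
    rw [this]
    simp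
  · have hinj : Function.Injective
        (fun P : NetPath (edge H) i j => P.steps.reverse) := by
      rintro ⟨a, _, _, _, _⟩ ⟨b, _, _, _, _⟩ h
      have : a = b := List.reverse_injective h
      subst this
      rfl
    have hsum : ∑' r, revW H i r j =
        ∑' P : NetPath (edge H) i j, revW H i P.steps.reverse j := by
      symm
      apply hinj.tsum_eq (f := fun r => revW H i r j)
      intro r hr
      have hg : GoodP H i j r.reverse := by
        by_contra hc
        apply hr
        simp [revW_eq, hc]
      obtain ⟨h1, h2, h3⟩ := hg
      have hne : r.reverse ≠ [] := by
        intro h0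
        simp only [h0] at h2
        exact hij (by simpa using h2)
      refine ⟨⟨r.reverse, hne, h1, ?_, h3⟩, by simp⟩
      rw [← h2, List.getLast_cons hne]
    rw [if_neg hij, zero_add, hsum, ENNReal.tsum_toReal_eq]
    · refine tsum_congr fun P => ?_
      have hg : GoodP H i j P.steps.reverse.reverse := by
        rw [List.reverse_reverse]; exact netPath_good H P
      rw [revW_eq, if_pos hg, List.map_reverse, List.prod_reverse]
      unfold pweight
      generalize P.steps = l
      induction l with
      | nil => simp
      | cons v l ih =>
        rw [List.map_cons, List.prod_cons, ih, List.map_cons, List.prod_cons,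
          ENNReal.toReal_mul]
        simp
    · intro P
      refine ne_top_of_le_ne_top ENNReal.one_ne_top (le_trans ?_ (tsum_revW_le H i j))
      exact ENNReal.le_tsum _

theorem effect_recursion (p : ℕ) (hp : 2 ≤ p) (H : Fin p → Fin p → Bool)
    (hdiag : ∀ i : Fin p, H i i = false) (i j : Fin p)
    (h : Nonempty (NetPath (edge H) i j)) :
    effect H i j =
      (1 / ((parents H j).card : ℝ)) * ∑ k ∈ parents H j, effect H i k := by
  obtain ⟨P⟩ := h
  have hij := netPath_ne P
  have key := tsum_revW_ne H i j hij (fun _ => 1)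
  simp only [mul_one] at key
  rw [effect_eq, key, ENNReal.toReal_mul, ENNReal.toReal_sum]
  · simp [effect_eq]
  · intro k _
    exact ne_top_of_le_ne_top ENNReal.one_ne_top (tsum_revW_le H i k)
end

section
/- For every unweighted network H on V and every fixed vertex i ∈ V, the vector v ∈ ℝ^p defined by v_k = e_ik satisfies M^(i) v = v and v_i = 1. -/
open Classical in
/-- The matrix `M^(i)`: row `i` is the Kronecker delta; for `k` with `H(i→k) ≠ ∅`
the entry `M_{km}` is `1/|H(•,k)|` whenever `m ∈ H(•,k)`; all other entries are `0`. -/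
noncomputable def Mmat {p : ℕ} (H : Fin p → Fin p → Bool) (i : Fin p) :
    Matrix (Fin p) (Fin p) ℝ :=
  Matrix.of fun k m =>
    if k = i then (if m = i then (1 : ℝ) else 0)
    else if Nonempty (NetPath (edge H) i k) ∧ m ∈ parents H k then
      (1 : ℝ) / ((parents H k).card : ℝ)
    else 0

open scoped ENNReal

noncomputable def EffAux.F {p : ℕ} (H : Fin p → Fin p → Bool) (i : Fin p) :
    List (Fin p) → Fin p → ℝ≥0∞
  | [], k => if k = i then 1 else 0
  | a :: l, k => if a = k ∧ k ≠ i then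
      ((parents H k).card : ℝ≥0∞)⁻¹ * ∑ m ∈ parents H k, EffAux.F H i l m else 0

namespace EffAux

variable {p : ℕ}

def listEquiv (α : Type) : Unit ⊕ (α × List α) ≃ List α where
  toFun x := match x with
    | Sum.inl _ => []
    | Sum.inr (a, l) => a :: l
  invFun l := match l with
    | [] => Sum.inl ()
    | a :: l => Sum.inr (a, l)
  left_inv x := by rcases x with _ | ⟨a, l⟩ <;> rfl
  right_inv l := by cases l <;> rfl

lemma tsum_list {α : Type} (f : List α → ℝ≥0∞) :
    ∑' l, f l = f [] + ∑' a, ∑' l, f (a :: l) := by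
  rw [← (listEquiv α).tsum_eq, Summable.tsum_sum ENNReal.summable ENNReal.summable,
    ENNReal.tsum_prod']
  congr 1
  rw [tsum_eq_single () (by intro b hb; exact absurd rfl hb)]
  rfl

/-- truncated recursion -/
lemma tsum_F (H : Fin p → Fin p → Bool) (i k : Fin p) (c : List (Fin p) → ℝ≥0∞) :
    ∑' l, c l * F H i l k = c [] * (if k = i then 1 else 0) + if k ≠ i then
      ((parents H k).card : ℝ≥0∞)⁻¹ * ∑ m ∈ parents H k, ∑' l, c (k :: l) * F H i l m else 0 := by
  rw [tsum_list]
  congr 1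
  rw [tsum_eq_single k]
  · by_cases hk : k = i
    · simp [F, hk]
    · simp only [F, hk, ne_eq, not_false_eq_true, and_self, if_true]
      rw [← Summable.tsum_finsetSum (fun _ _ => ENNReal.summable), ← ENNReal.tsum_mul_left]
      refine tsum_congr fun l => ?_
      rw [← Finset.mul_sum]
      ring
  · intro b hb
    simp [F, hb]

lemma trunc_le (H : Fin p → Fin p → Bool) (i : Fin p) (n : ℕ) : ∀ k,
    ∑' l : List (Fin p), (if l.length < n then 1 else 0) * F H i l k ≤ 1 := by
  induction n with
  | zero => simp
  | succ n ih =>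
    intro k
    rw [tsum_F]
    by_cases hk : k = i
    · simp [hk]
    · simp only [hk, if_false, mul_zero, zero_add, ne_eq, not_false_eq_true, if_true,
        List.length_cons, Nat.add_lt_add_iff_right]
      calc _ ≤ ((parents H k).card : ℝ≥0∞)⁻¹ * ∑ m ∈ parents H k, 1 := by
            gcongr with m hm
            exact ih m
        _ ≤ 1 := by
            simp only [Finset.sum_const, nsmul_eq_mul, mul_one]
            exact ENNReal.inv_mul_le_one _

noncomputable def E (H : Fin p → Fin p → Bool) (i k : Fin p) : ℝ≥0∞ := ∑' l, F H i l k

lemma E_le (H : Fin p → Fin p → Bool) (i k : Fin p) : E H i k ≤ 1 := by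
  rw [E, ENNReal.tsum_eq_iSup_sum]
  refine iSup_le fun s => ?_
  refine le_trans ?_ (trunc_le H i (s.sup List.length + 1) k)
  refine le_trans (le_of_eq ?_) (ENNReal.sum_le_tsum s)
  refine Finset.sum_congr rfl fun l hl => ?_
  rw [if_pos (Nat.lt_succ_of_le (Finset.le_sup hl)), one_mul]

lemma E_rec (H : Fin p → Fin p → Bool) (i k : Fin p) :
    E H i k = (if k = i then 1 else 0) + if k ≠ i then
      ((parents H k).card : ℝ≥0∞)⁻¹ * ∑ m ∈ parents H k, E H i m else 0 := by
  simpa [E] using tsum_F H i k (fun _ => 1)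

def valid (H : Fin p → Fin p → Bool) (i k : Fin p) (l : List (Fin p)) : Prop :=
  List.IsChain (edge H) (i :: l.reverse) ∧ (i :: l.reverse).getLast? = some k ∧ ∀ v ∈ l, v ≠ i

lemma valid_unique {H : Fin p → Fin p → Bool} {i k k' : Fin p} {l : List (Fin p)}
    (h : valid H i k l) (h' : valid H i k' l) : k = k' := by
  have := h.2.1.symm.trans h'.2.1
  simpa using this

lemma valid_cons (H : Fin p → Fin p → Bool) (i k a : Fin p) (l : List (Fin p)) :
    valid H i k (a :: l) ↔ (a = k ∧ k ≠ i) ∧ ∃ m ∈ parents H k, valid H i m l := by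
  have e : i :: (a :: l).reverse = (i :: l.reverse) ++ [a] := by simp
  simp only [valid, e, List.isChain_append, List.getLast?_append, parents]
  constructor
  · rintro ⟨⟨h1, -, h3⟩, h4, h5⟩
    have hak : a = k := by simpa using h4
    subst hak
    refine ⟨⟨rfl, h5 a (by simp)⟩, (i :: l.reverse).getLast (by simp), ?_, h1, ?_, ?_⟩
    · have := h3 ((i :: l.reverse).getLast (by simp))
        (by rw [List.getLast?_eq_some_getLast (by simp)]; rfl) a (by simp)
      simpa [edge] using this
    · rw [List.getLast?_eq_some_getLast (by simp)]
    · exact fun v hv => h5 v (by simp [hv])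
  · rintro ⟨⟨rfl, hk⟩, m, hm, h1, h2, h3⟩
    refine ⟨⟨h1, by simp, ?_⟩, by simp, ?_⟩
    · intro x hx y hy
      rw [h2] at hx
      simp at hx hy
      subst hx hy
      simpa [edge] using hm
    · intro v hv
      rcases List.mem_cons.1 hv with rfl | hv
      · exact hk
      · exact h3 v hv

open Classical in
lemma F_eq (H : Fin p → Fin p → Bool) (i : Fin p) (l : List (Fin p)) : ∀ k,
    F H i l k = if valid H i k l then
      (l.map fun v => ((parents H v).card : ℝ≥0∞)⁻¹).prod else 0 := by
  induction l with
  | nil => intro k; simp [F, valid, eq_comm]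
  | cons a l ih =>
    intro k
    rw [F]
    by_cases h : valid H i k (a :: l)
    · rw [if_pos h]
      obtain ⟨h1, m, hm, hv⟩ := (valid_cons ..).1 h
      rw [if_pos h1, Finset.sum_eq_single m, ih, if_pos hv, h1.1]
      · simp
      · intro b _ hb
        rw [ih, if_neg]
        exact fun hb' => hb (valid_unique hb' hv)
      · exact fun h => absurd hm h
    · rw [if_neg h]
      split_ifs with h1
      · rw [Finset.sum_eq_zero, mul_zero]
        intro m hm
        rw [ih, if_neg]
        exact fun hv => h ((valid_cons ..).2 ⟨h1, m, hm, hv⟩)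
      · rfl

lemma valid_path {H : Fin p → Fin p → Bool} {i k : Fin p} (P : NetPath (edge H) i k) :
    valid H i k P.steps.reverse := by
  obtain ⟨s, ne, ch, la, av⟩ := P
  refine ⟨?_, ?_, ?_⟩
  · have ch' : List.IsChain (edge H) (i :: s) := ch
    simpa using ch'
  · simp only [List.reverse_reverse]
    rw [List.getLast?_eq_some_getLast (by simp), List.getLast_cons ne, la]
  · simpa using av

lemma ne_path {H : Fin p → Fin p → Bool} {i k : Fin p} (P : NetPath (edge H) i k) : k ≠ i := by
  have := P.avoid _ (List.getLast_mem P.ne)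
  rwa [P.last] at this

lemma E_toReal (H : Fin p → Fin p → Bool) (i k : Fin p) : effect H i k = (E H i k).toReal := by
  by_cases hk : k = i
  · subst hk
    have : IsEmpty (NetPath (edge H) k k) := ⟨fun P => ne_path P rfl⟩
    rw [E_rec]
    simp [effect]
  · have hinj : Function.Injective (fun P : NetPath (edge H) i k => P.steps.reverse) := by
      rintro ⟨s, _, _, _, _⟩ ⟨s', _, _, _, _⟩ h
      have h' : s = s' := List.reverse_injective h
      subst h'
      rfl
    have hsupp : Function.support (fun l => F H i l k) ⊆
        Set.range (fun P : NetPath (edge H) i k => P.steps.reverse) := by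
      intro l hl
      rw [Function.mem_support, F_eq] at hl
      have hv : valid H i k l := by
        by_contra h
        exact hl (if_neg h)
      have hne : l.reverse ≠ [] := by
        rintro h
        have := hv.2.1
        rw [h] at this
        simp at this
        exact hk this.symm
      refine ⟨⟨l.reverse, hne, hv.1, ?_, ?_⟩, by simp⟩
      · have := hv.2.1
        rw [List.getLast?_eq_some_getLast (by simp), List.getLast_cons hne] at this
        exact Option.some.inj this
      · simpa using hv.2.2
    have hfin : ∀ l, F H i l k ≠ ∞ := fun l =>
      ne_top_of_le_ne_top ENNReal.one_ne_top ((ENNReal.le_tsum l).trans (E_le H i k))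
    rw [E, ← hinj.tsum_eq hsupp, ENNReal.tsum_toReal_eq (fun _ => hfin _), effect,
      if_neg (Ne.symm hk), zero_add]
    refine tsum_congr fun P => ?_
    rw [F_eq, if_pos (valid_path P), List.map_reverse, List.prod_reverse, pweight]
    generalize P.steps = s
    induction s with
    | nil => simp
    | cons a s ih =>
      rw [List.map_cons, List.prod_cons, ih, List.map_cons, List.prod_cons, ENNReal.toReal_mul]
      simp

end EffAux

theorem effects_fixed_vector (p : ℕ) (hp : 2 ≤ p) (H : Fin p → Fin p → Bool)
    (hdiag : ∀ i : Fin p, H i i = false) (i : Fin p) :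
    (Mmat H i).mulVec (fun k => effect H i k) = (fun k => effect H i k) ∧
      effect H i i = 1 := by
  refine ⟨?_, ?_⟩
  · funext k
    simp only [Matrix.mulVec, dotProduct, Mmat, Matrix.of_apply]
    by_cases hk : k = i
    · subst hk
      simp
    · simp only [hk, if_false]
      by_cases hn : Nonempty (NetPath (edge H) i k)
      · simp only [hn, true_and, ite_mul, zero_mul]
        rw [Finset.sum_ite_mem, Finset.univ_inter, ← Finset.mul_sum, EffAux.E_toReal H i k,
          EffAux.E_rec]
        simp only [hk, if_false, zero_add, ne_eq, not_false_eq_true, if_true]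
        rw [ENNReal.toReal_mul, ENNReal.toReal_sum (fun m _ =>
          ne_top_of_le_ne_top ENNReal.one_ne_top (EffAux.E_le H i m))]
        simp [EffAux.E_toReal]
      · have : IsEmpty (NetPath (edge H) i k) := not_nonempty_iff.1 hn
        simp only [hn, false_and, if_false]
        simp [effect, Ne.symm hk]
  · rw [EffAux.E_toReal, EffAux.E_rec]
    simp
end

section
/- For every unweighted network H on V, every fixed vertex i ∈ V, and every vector v ∈ ℝ^p: if M^(i) v = v, then |v_k| ≤ |v_i| for all k ∈ V. -/
theorem aux_step {p : ℕ} (H : Fin p → Fin p → Bool) (i : Fin p) (v : Fin p → ℝ)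
    (hv : (Mmat H i).mulVec v = v) (m : ℝ) (hm : 0 < m) (hmax : ∀ u, |v u| ≤ m)
    (a b : Fin p) (hb : b ≠ i) (hbm : |v b| = m) (hab : H a b = true) : |v a| = m := by
  classical
  have h := congrFun hv b
  simp only [Matrix.mulVec, dotProduct, Mmat, Matrix.of_apply, if_neg hb] at h
  by_cases hr : Nonempty (NetPath (edge H) i b)
  · simp only [hr, true_and, ite_mul, zero_mul] at h
    rw [← Finset.sum_filter, Finset.filter_mem_eq_inter, Finset.univ_inter,
      ← Finset.mul_sum] at h
    have ha : a ∈ parents H b := by simp [parents, hab]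
    have hc : (0 : ℝ) < ((parents H b).card : ℝ) := by
      exact_mod_cast Finset.card_pos.mpr ⟨a, ha⟩
    by_contra hne
    have hlt : |v a| < m := lt_of_le_of_ne (hmax a) hne
    have h1 : ∑ u ∈ parents H b, |v u| < ∑ u ∈ parents H b, m :=
      Finset.sum_lt_sum (fun u _ => hmax u) ⟨a, ha, hlt⟩
    have h2 : ∑ u ∈ parents H b, v u = (parents H b).card * v b := by
      rw [← h]; field_simp
    have h3 := Finset.abs_sum_le_sum_abs v (parents H b)
    rw [h2, abs_mul, hbm, abs_of_pos hc] at h3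
    rw [Finset.sum_const, nsmul_eq_mul] at h1
    linarith
  · simp only [hr, false_and, if_false, zero_mul, Finset.sum_const_zero] at h
    rw [← h, abs_zero] at hbm
    linarith

theorem aux_chain {p : ℕ} (H : Fin p → Fin p → Bool) (i : Fin p) (v : Fin p → ℝ)
    (hv : (Mmat H i).mulVec v = v) (m : ℝ) (hm : 0 < m) (hmax : ∀ u, |v u| ≤ m)
    (L : List (Fin p)) : ∀ (a : Fin p), List.IsChain (edge H) (a :: L) → (∀ x ∈ L, x ≠ i) →
      |v ((a :: L).getLast (List.cons_ne_nil a L))| = m → |v a| = m := by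
  induction L with
  | nil => intro a _ _ h; simpa using h
  | cons b L ih =>
    intro a hc hav hl
    rw [List.isChain_cons_cons] at hc
    rw [List.getLast_cons (List.cons_ne_nil b L)] at hl
    exact aux_step H i v hv m hm hmax a b (hav b (by simp))
      (ih b hc.2 (fun x hx => hav x (by simp [hx])) hl) hc.1

theorem fixed_vector_max_at_i (p : ℕ) (hp : 2 ≤ p) (H : Fin p → Fin p → Bool)
    (hdiag : ∀ i : Fin p, H i i = false) (i : Fin p) (v : Fin p → ℝ)
    (hv : (Mmat H i).mulVec v = v) :
    ∀ k : Fin p, |v k| ≤ |v i| := by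
  classical
  obtain ⟨k0, -, hk0⟩ := Finset.exists_max_image Finset.univ (fun k => |v k|) ⟨i, Finset.mem_univ i⟩
  have hmax : ∀ u, |v u| ≤ |v k0| := fun u => hk0 u (Finset.mem_univ u)
  suffices hs : |v k0| ≤ |v i| from fun k => (hmax k).trans hs
  by_cases hki : k0 = i
  · rw [hki]
  by_cases hr : Nonempty (NetPath (edge H) i k0)
  · rcases (abs_nonneg (v k0)).eq_or_lt with h0 | hpos
    · rw [← h0]; exact abs_nonneg _
    · obtain ⟨P⟩ := hr
      refine (aux_chain H i v hv _ hpos hmax P.steps i P.chain P.avoid ?_).ge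
      rw [List.getLast_cons P.ne, P.last]
  · have h := congrFun hv k0
    simp only [Matrix.mulVec, dotProduct, Mmat, Matrix.of_apply, if_neg hki, hr, false_and,
      if_false, zero_mul, Finset.sum_const_zero] at h
    rw [← h, abs_zero]; exact abs_nonneg _
end

section
/- For every unweighted network H on V and every fixed vertex i ∈ V, there exists a vector v ∈ ℝ^p such that M^(i) v = v and v_i = 1. -/
theorem Mmat_row {p : ℕ} (H : Fin p → Fin p → Bool) (i k : Fin p) (hk : k ≠ i)
    (hr : Nonempty (NetPath (edge H) i k)) (v : Fin p → ℝ) :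
    (Mmat H i).mulVec v k = (∑ m ∈ parents H k, v m) / ((parents H k).card : ℝ) := by
  classical
  simp only [Mmat, Matrix.mulVec, dotProduct, Matrix.of_apply, hk, hr, if_false, true_and, ite_mul,
    zero_mul]
  rw [Finset.sum_ite_mem, Finset.univ_inter, Finset.sum_div]
  exact Finset.sum_congr rfl fun m _ => by ring

theorem Mmat_row_zero {p : ℕ} (H : Fin p → Fin p → Bool) (i k : Fin p) (hk : k ≠ i)
    (hr : ¬ Nonempty (NetPath (edge H) i k)) (v : Fin p → ℝ) :
    (Mmat H i).mulVec v k = 0 := by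
  classical
  simp [Mmat, Matrix.mulVec, dotProduct, Matrix.of_apply, hk, hr]

theorem Mmat_row_self {p : ℕ} (H : Fin p → Fin p → Bool) (i : Fin p) (v : Fin p → ℝ) :
    (Mmat H i).mulVec v i = v i := by
  classical
  simp [Mmat, Matrix.mulVec, dotProduct, Matrix.of_apply]

theorem chain_back {α : Type} (E : α → α → Prop) (S : α → Prop)
    (hS : ∀ u w, E u w → S w → S u) (l : List α) : ∀ (a : α) (_ : List.IsChain E (a :: l))
    (ne : l ≠ []), S (l.getLast ne) → S a := by
  induction l with
  | nil => intro a _ ne; exact absurd rfl ne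
  | cons b l ih =>
    intro a hc ne hl
    rw [List.isChain_cons_cons] at hc
    apply hS a b hc.1
    by_cases h : l = []
    · subst h; simpa using hl
    · exact ih b hc.2 h (by rwa [List.getLast_cons h] at hl)

theorem kernel_zero {p : ℕ} (H : Fin p → Fin p → Bool) (i : Fin p) (v : Fin p → ℝ)
    (hi : v i = 0) (hv : ∀ k, k ≠ i → (Mmat H i).mulVec v k = v k) : v = 0 := by
  obtain ⟨k, -, hmax⟩ := Finset.exists_max_image Finset.univ (fun k => |v k|) ⟨i, Finset.mem_univ i⟩
  by_contra hne
  have hc : 0 < |v k| := by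
    obtain ⟨m, hm⟩ := Function.ne_iff.mp hne
    exact lt_of_lt_of_le (abs_pos.mpr hm) (hmax m (Finset.mem_univ m))
  set c := |v k| with hcdef
  have hreach : ∀ w, |v w| = c → w ≠ i ∧ Nonempty (NetPath (edge H) i w) := by
    intro w hw
    have hwi : w ≠ i := by
      rintro rfl
      rw [hi, abs_zero] at hw
      exact hc.ne hw
    refine ⟨hwi, ?_⟩
    by_contra hr
    have := hv w hwi
    rw [Mmat_row_zero H i w hwi hr] at this
    rw [← this, abs_zero] at hw
    exact hc.ne hw
  have hback : ∀ u w, edge H u w → |v w| = c → |v u| = c := by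
    intro u w he hw
    obtain ⟨hwi, hr⟩ := hreach w hw
    have h1 := hv w hwi
    rw [Mmat_row H i w hwi hr] at h1
    have hu : u ∈ parents H w := by simpa [parents, edge] using he
    by_contra hlt
    have hlt : |v u| < c := lt_of_le_of_ne (hmax u (Finset.mem_univ u)) hlt
    have hn : (0 : ℝ) < ((parents H w).card : ℝ) := by
      exact_mod_cast Finset.card_pos.mpr ⟨u, hu⟩
    have h2 : ∑ m ∈ parents H w, |v m| < ∑ m ∈ parents H w, c :=
      Finset.sum_lt_sum (fun m _ => hmax m (Finset.mem_univ m)) ⟨u, hu, hlt⟩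
    have h3 := Finset.abs_sum_le_sum_abs v (parents H w)
    rw [Finset.sum_const, nsmul_eq_mul] at h2
    rw [div_eq_iff hn.ne'] at h1
    rw [h1, abs_mul, hw, abs_of_pos hn] at h3
    linarith
  obtain ⟨-, ⟨P⟩⟩ := hreach k rfl
  have := chain_back (edge H) (fun w => |v w| = c) hback P.steps i P.chain P.ne
    (by rw [P.last])
  exact (hreach i this).1 rfl

theorem fixed_vector_exists (p : ℕ) (hp : 2 ≤ p) (H : Fin p → Fin p → Bool)
    (hdiag : ∀ i : Fin p, H i i = false) (i : Fin p) :
    ∃ v : Fin p → ℝ, (Mmat H i).mulVec v = v ∧ v i = 1 := by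
  let f : (Fin p → ℝ) →ₗ[ℝ] (Fin p → ℝ) :=
    { toFun := fun v k => if k = i then v i else v k - (Mmat H i).mulVec v k
      map_add' := by
        intro x y
        ext k
        by_cases h : k = i
        · simp [h]
        · simp [h, Matrix.mulVec_add]; ring
      map_smul' := by
        intro r x
        ext k
        by_cases h : k = i
        · simp [h]
        · simp [h, Matrix.mulVec_smul]; ring }
  have hf : ∀ v k, f v k = if k = i then v i else v k - (Mmat H i).mulVec v k := fun _ _ => rfl
  have hinj : Function.Injective f := by
    rw [injective_iff_map_eq_zero]
    intro v hv
    apply kernel_zero H i v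
    · have := congrFun hv i
      simpa [hf] using this
    · intro k hk
      have := congrFun hv k
      rw [hf, if_neg hk] at this
      simp only [Pi.zero_apply] at this
      linarith
  obtain ⟨v, hv⟩ := LinearMap.injective_iff_surjective.mp hinj (Pi.single i 1)
  refine ⟨v, ?_, ?_⟩
  · ext k
    by_cases hk : k = i
    · subst hk; exact Mmat_row_self H k v
    · have := congrFun hv k
      rw [hf, if_neg hk, Pi.single_eq_of_ne hk] at this
      linarith
  · have := congrFun hv i
    simpa [hf] using this
end

section
/- For every unweighted network H on V and every fixed vertex i ∈ V, the solution to the fixed-point problem is unique: if v, v' ∈ ℝ^p satisfy M^(i) v = v, v_i = 1, M^(i) v' = v', and v'_i = 1, then v = v'. -/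
theorem step_back {p : ℕ} (H : Fin p → Fin p → Bool) (i : Fin p) (d : Fin p → ℝ)
    (hd : (Mmat H i).mulVec d = d) (c : ℝ) (hc : 0 < c) (hmax : ∀ k, d k ≤ c)
    (u w : Fin p) (hE : edge H u w) (hw : w ≠ i) (hdw : d w = c) : d u = c := by
  classical
  have hrow := congrFun hd w
  simp only [Matrix.mulVec, dotProduct, Mmat, Matrix.of_apply, if_neg hw] at hrow
  by_cases hr : Nonempty (NetPath (edge H) i w)
  · simp only [hr, true_and, ite_mul, zero_mul, Finset.sum_ite_mem, Finset.univ_inter] at hrow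
    have hu : u ∈ parents H w := by
      simpa [parents, edge] using hE
    have hpos : (0 : ℝ) < ((parents H w).card : ℝ) := by
      exact_mod_cast Finset.card_pos.mpr ⟨u, hu⟩
    rw [← Finset.mul_sum, hdw] at hrow
    have hs : ∑ m ∈ parents H w, d m = (parents H w).card * c := by
      rw [← hrow]
      field_simp
    have h0 : ∑ m ∈ parents H w, (c - d m) = 0 := by
      rw [Finset.sum_sub_distrib, hs]
      simp
    have := (Finset.sum_eq_zero_iff_of_nonneg (fun m _ => sub_nonneg.mpr (hmax m))).mp h0 u hu
    linarith
  · simp only [hr, false_and, if_false, zero_mul, Finset.sum_const_zero] at hrow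
    linarith

theorem chain_back_s9 {p : ℕ} (H : Fin p → Fin p → Bool) (i : Fin p) (d : Fin p → ℝ) (c : ℝ)
    (hstep : ∀ u w, edge H u w → w ≠ i → d w = c → d u = c) (l : List (Fin p)) :
    ∀ (a : Fin p) (hne : l ≠ []), List.IsChain (edge H) (a :: l) → (∀ x ∈ l, x ≠ i) →
      d (l.getLast hne) = c → d a = c := by
  induction l with
  | nil => intro a hne; exact absurd rfl hne
  | cons b t ih =>
    intro a hne hch hav hl
    rw [List.isChain_cons_cons] at hch
    refine hstep a b hch.1 (hav b (by simp)) ?_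
    by_cases ht : t = []
    · subst ht
      simpa using hl
    · refine ih b ht hch.2 (fun x hx => hav x (by simp [hx])) ?_
      rwa [List.getLast_cons ht] at hl

theorem fixed_nonpos {p : ℕ} (H : Fin p → Fin p → Bool) (i : Fin p) (d : Fin p → ℝ)
    (hd : (Mmat H i).mulVec d = d) (hi : d i = 0) (k : Fin p) : d k ≤ 0 := by
  classical
  by_contra hk
  push Not at hk
  obtain ⟨w, -, hw⟩ := Finset.exists_max_image Finset.univ d ⟨k, Finset.mem_univ k⟩
  have hc : 0 < d w := lt_of_lt_of_le hk (hw k (Finset.mem_univ k))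
  have hwi : w ≠ i := by
    rintro rfl
    linarith
  have hr : Nonempty (NetPath (edge H) i w) := by
    by_contra hr
    have hrow := congrFun hd w
    simp only [Matrix.mulVec, dotProduct, Mmat, Matrix.of_apply, if_neg hwi, hr, false_and,
      if_false, zero_mul, Finset.sum_const_zero] at hrow
    linarith
  obtain ⟨P⟩ := hr
  have := chain_back_s9 H i d (d w)
    (fun u x => step_back H i d hd (d w) hc (fun m => hw m (Finset.mem_univ m)) u x)
    P.steps i P.ne P.chain P.avoid (by rw [P.last])
  linarith

theorem fixed_vector_unique (p : ℕ) (hp : 2 ≤ p) (H : Fin p → Fin p → Bool)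
    (hdiag : ∀ i : Fin p, H i i = false) (i : Fin p) (v v' : Fin p → ℝ)
    (hv : (Mmat H i).mulVec v = v) (hvi : v i = 1)
    (hv' : (Mmat H i).mulVec v' = v') (hvi' : v' i = 1) :
    v = v' := by
  have key : ∀ a b : Fin p → ℝ, (Mmat H i).mulVec a = a → a i = 1 →
      (Mmat H i).mulVec b = b → b i = 1 → ∀ k, a k ≤ b k := by
    intro a b ha hai hb hbi k
    have := fixed_nonpos H i (a - b) (by rw [Matrix.mulVec_sub, ha, hb]) (by simp [hai, hbi]) k
    simpa using this
  funext k
  exact le_antisymm (key v v' hv hvi hv' hvi' k) (key v' v hv' hvi' hv hvi k)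
end

section
/- For every unweighted network H on V and every fixed vertex i ∈ V, if v ∈ ℝ^p satisfies M^(i) v = v and v_i = 1, then v_j = e_ij for all j ∈ V; that is, the row of effects (e_i1, …, e_ip) is the unique fixed vector of M^(i) normalised by v_i = 1. -/
/-- Weight of a reversed walk (a list of steps read backwards from `k`). -/
noncomputable def gw {p : ℕ} (H : Fin p → Fin p → Bool) (i : Fin p) :
    List (Fin p) → Fin p → ENNReal
  | [], k => if k = i then 1 else 0
  | x :: L, k => if x = k ∧ k ≠ i then
      ENNReal.ofReal (1 / ((parents H k).card : ℝ)) * ∑ m ∈ parents H k, gw H i L m else 0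

open Classical in
theorem gw_reverse {p : ℕ} (H : Fin p → Fin p → Bool) (i : Fin p) (s : List (Fin p)) :
    ∀ j, gw H i s.reverse j =
      if List.IsChain (edge H) (i :: s) ∧ (i :: s).getLast (by simp) = j ∧ (∀ v ∈ s, v ≠ i) then
        ENNReal.ofReal (s.map fun v => (1 : ℝ) / ((parents H v).card : ℝ)).prod else 0 := by
  induction s using List.reverseRecOn with
  | nil => intro j; simp [gw, eq_comm]
  | append_singleton s x ih =>
    intro j
    have hch : List.IsChain (edge H) (i :: (s ++ [x])) ↔
        List.IsChain (edge H) (i :: s) ∧ edge H ((i :: s).getLast (by simp)) x := by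
      rw [← List.cons_append, List.isChain_append]
      simp [List.getLast?_eq_getLast_of_ne_nil]
    simp only [List.reverse_append, List.reverse_cons, List.reverse_nil, List.nil_append,
      List.cons_append, gw, ih, hch]
    by_cases hx : x = j
    · subst hx
      by_cases hxi : x = i
      · simp [hxi]
      · by_cases hA : List.IsChain (edge H) (i :: s) ∧ (∀ v ∈ s, v ≠ i)
        · obtain ⟨h1, h2⟩ := hA
          have h3 : ∀ v ∈ s ++ [x], v ≠ i := by
            intro v hv
            rcases List.mem_append.1 hv with h | h
            · exact h2 v h
            · simp at h; rw [h]; exact hxi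
          have h4 : ((i :: s).getLast (by simp) ∈ parents H x) ↔
              edge H ((i :: s).getLast (by simp)) x := by simp [parents, edge]
          have h5 : (i :: (s ++ [x])).getLast (by simp) = x := by simp
          simp only [h1, true_and, eq_true h2, eq_true h3, h5, and_true, Finset.sum_ite_eq, h4,
            eq_true (show x ≠ i from hxi), if_true]
          split_ifs with h
          · rw [← ENNReal.ofReal_mul (by positivity)]
            simp [mul_comm]
          · simp
        · rw [if_neg (c := (_ ∧ _) ∧ _)]
          · have : ∀ m, ¬ (List.IsChain (edge H) (i :: s) ∧ (i :: s).getLast (by simp) = m ∧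
                (∀ v ∈ s, v ≠ i)) := fun m h => hA ⟨h.1, h.2.2⟩
            simp [this]
          · rintro ⟨⟨h1, -⟩, -, h3⟩
            exact hA ⟨h1, fun v hv => h3 v (by simp [hv])⟩
    · simp [hx]

theorem tsum_list {α : Type*} [Fintype α] (f : List α → ENNReal) :
    ∑' L, f L = f [] + ∑ x, ∑' L, f (x :: L) := by
  let e : Unit ⊕ (α × List α) ≃ List α :=
    { toFun := fun o => o.elim (fun _ => []) (fun q => q.1 :: q.2)
      invFun := fun L => match L with
        | [] => Sum.inl ()
        | x :: L => Sum.inr (x, L)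
      left_inv := by rintro (_ | ⟨x, L⟩) <;> rfl
      right_inv := by rintro (_ | ⟨x, L⟩) <;> rfl }
  rw [← e.tsum_eq, Summable.tsum_sum ENNReal.summable ENNReal.summable,
    tsum_fintype, Fintype.sum_unique]
  have h := ENNReal.tsum_prod (f := fun (x : α) (L : List α) => f (x :: L))
  rw [← tsum_fintype (L := SummationFilter.unconditional α) (fun x : α => ∑' L, f (x :: L)), ← h]
  rfl

theorem avg_le {p : ℕ} (H : Fin p → Fin p → Bool) (k : Fin p) (f : Fin p → ENNReal)
    (hf : ∀ m, f m ≤ 1) :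
    ENNReal.ofReal (1 / ((parents H k).card : ℝ)) * ∑ m ∈ parents H k, f m ≤ 1 := by
  calc _ ≤ ENNReal.ofReal (1 / ((parents H k).card : ℝ)) * ∑ m ∈ parents H k, 1 := by
        gcongr; exact hf _
    _ = ENNReal.ofReal (1 / ((parents H k).card : ℝ)) *
          ENNReal.ofReal ((parents H k).card : ℝ) := by simp
    _ = ENNReal.ofReal (1 / ((parents H k).card : ℝ) * ((parents H k).card : ℝ)) := by
        rw [ENNReal.ofReal_mul (by positivity)]
    _ ≤ 1 := by
        rw [ENNReal.ofReal_le_one]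
        rcases eq_or_ne ((parents H k).card : ℝ) 0 with h | h
        · simp [h]
        · rw [one_div_mul_cancel h]

theorem gw_tsum_rec {p : ℕ} (H : Fin p → Fin p → Bool) (i k : Fin p) (hk : k ≠ i) :
    ∑' L, gw H i L k = ENNReal.ofReal (1 / ((parents H k).card : ℝ)) *
      ∑ m ∈ parents H k, ∑' L, gw H i L m := by
  rw [tsum_list]
  simp only [gw, hk, ne_eq, not_false_eq_true, and_true, if_false, zero_add]
  rw [Finset.sum_eq_single k]
  · simp only [if_true]
    rw [ENNReal.tsum_mul_left, Summable.tsum_finsetSum (fun _ _ => ENNReal.summable)]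
  · intro b _ hb; simp [hb]
  · simp

theorem gw_tsum_self {p : ℕ} (H : Fin p → Fin p → Bool) (i : Fin p) :
    ∑' L, gw H i L i = 1 := by
  rw [tsum_list]; simp [gw]

theorem gw_trunc {p : ℕ} (H : Fin p → Fin p → Bool) (i : Fin p) (n : ℕ) :
    ∀ k, ∑' L : List (Fin p), (if L.length < n then gw H i L k else 0) ≤ 1 := by
  induction n with
  | zero => intro k; simp
  | succ n ih =>
    intro k
    rw [tsum_list]
    by_cases hk : k = i
    · simp [gw, hk]
    · simp only [gw, hk, ne_eq, not_false_eq_true, and_true, if_false, ite_self, zero_add,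
        List.length_cons, Nat.add_lt_add_iff_right]
      rw [Finset.sum_eq_single k]
      · simp only [if_true]
        have : ∀ L : List (Fin p), (if L.length < n then
            ENNReal.ofReal (1 / ((parents H k).card : ℝ)) * ∑ m ∈ parents H k, gw H i L m else 0)
            = ENNReal.ofReal (1 / ((parents H k).card : ℝ)) * ∑ m ∈ parents H k,
              (if L.length < n then gw H i L m else 0) := by
          intro L; split_ifs <;> simp
        simp only [this]
        rw [ENNReal.tsum_mul_left, Summable.tsum_finsetSum (fun _ _ => ENNReal.summable)]
        exact avg_le H k _ ih
      · intro b _ hb; simp [hb]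
      · simp

theorem gw_le_one {p : ℕ} (H : Fin p → Fin p → Bool) (i k : Fin p) :
    ∑' L, gw H i L k ≤ 1 := by
  rw [ENNReal.tsum_eq_iSup_sum]
  refine iSup_le fun s => ?_
  refine le_trans ?_ (gw_trunc H i (s.sup List.length + 1) k)
  refine le_trans (le_of_eq ?_) (ENNReal.sum_le_tsum s)
  refine Finset.sum_congr rfl fun L hL => ?_
  rw [if_pos]
  exact Nat.lt_succ_of_le (Finset.le_sup (f := List.length) hL)

theorem gw_support {p : ℕ} (H : Fin p → Fin p → Bool) (i k : Fin p) (hk : k ≠ i)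
    (L : List (Fin p)) (h : gw H i L k ≠ 0) :
    ∃ P : NetPath (edge H) i k, P.steps.reverse = L := by
  have h1 := gw_reverse H i L.reverse k
  rw [List.reverse_reverse] at h1
  rw [h1] at h
  split_ifs at h with hc
  · obtain ⟨a, b, c⟩ := hc
    have hne : L.reverse ≠ [] := by
      intro h0
      simp only [h0, List.getLast_singleton] at b
      exact hk b.symm
    refine ⟨⟨L.reverse, hne, a, ?_, c⟩, by simp⟩
    rw [← b, List.getLast_cons hne]
  · exact absurd rfl h

theorem gw_path {p : ℕ} (H : Fin p → Fin p → Bool) (i k : Fin p)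
    (P : NetPath (edge H) i k) : gw H i P.steps.reverse k = ENNReal.ofReal (pweight H P) := by
  rw [gw_reverse, if_pos]
  · rfl
  · refine ⟨P.chain, ?_, P.avoid⟩
    rw [List.getLast_cons P.ne, P.last]

theorem gw_effect {p : ℕ} (H : Fin p → Fin p → Bool) (i j : Fin p) :
    (∑' L, gw H i L j).toReal = effect H i j := by
  by_cases hj : j = i
  · subst hj
    have : IsEmpty (NetPath (edge H) j j) :=
      ⟨fun P => P.avoid j (by have := List.getLast_mem P.ne; rwa [P.last] at this) rfl⟩
    rw [gw_tsum_self]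
    simp [effect]
  · have hinj : Function.Injective
        (fun P : NetPath (edge H) i j => P.steps.reverse) := by
      rintro ⟨a, _, _, _, _⟩ ⟨b, _, _, _, _⟩ h
      simp at h
      subst h
      rfl
    have := hinj.tsum_eq (f := fun L => gw H i L j)
      (fun L hL => gw_support H i j hj L hL)
    rw [← this]
    simp only [gw_path]
    rw [ENNReal.tsum_toReal_eq (fun _ => ENNReal.ofReal_ne_top)]
    rw [effect, if_neg (Ne.symm hj), zero_add]
    refine tsum_congr fun P => ENNReal.toReal_ofReal ?_
    refine List.prod_nonneg ?_
    intro a ha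
    obtain ⟨x, -, rfl⟩ := List.mem_map.1 ha
    positivity

theorem back_closed {p : ℕ} (H : Fin p → Fin p → Bool) (i : Fin p) (S : Fin p → Prop)
    (hS : ∀ k, S k → ∀ m, edge H m k → S m) (s : List (Fin p)) :
    List.IsChain (edge H) (i :: s) → S ((i :: s).getLast (by simp)) → S i := by
  induction s using List.reverseRecOn with
  | nil => intro _ h; simpa using h
  | append_singleton s x ih =>
    intro hc hl
    rw [← List.cons_append, List.isChain_append] at hc
    refine ih hc.1 (hS x (by simpa using hl) _ ?_)
    exact hc.2.2 _ (by simp [List.getLast?_eq_getLast_of_ne_nil]) x (by simp)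

theorem max_principle {p : ℕ} (H : Fin p → Fin p → Bool) (i : Fin p) (d : Fin p → ℝ)
    (h0 : d i = 0) (h1 : ∀ k, k ≠ i → ¬ Nonempty (NetPath (edge H) i k) → d k = 0)
    (h2 : ∀ k, k ≠ i → Nonempty (NetPath (edge H) i k) →
      d k = 1 / ((parents H k).card : ℝ) * ∑ m ∈ parents H k, d m) : ∀ k, d k = 0 := by
  obtain ⟨k, -, hk⟩ := Finset.exists_max_image Finset.univ (fun k => |d k|) ⟨i, by simp⟩
  by_contra! hne
  obtain ⟨k', hk'⟩ := hne
  have hD : 0 < |d k| := lt_of_lt_of_le (abs_pos.2 hk') (hk k' (by simp))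
  have key : ∀ a, |d a| = |d k| → a ≠ i ∧ Nonempty (NetPath (edge H) i a) := by
    intro a ha
    have hai : a ≠ i := by rintro rfl; rw [← ha, h0] at hD; simp at hD
    refine ⟨hai, ?_⟩
    by_contra hn
    rw [← ha, h1 a hai hn] at hD; simp at hD
  have hcl : ∀ a, |d a| = |d k| → ∀ m, edge H m a → |d m| = |d k| := by
    intro a ha m hm
    obtain ⟨hai, hP⟩ := key a ha
    have hmem : m ∈ parents H a := by simpa [parents, edge] using hm
    have hc : (0 : ℝ) < (parents H a).card := by
      exact_mod_cast Finset.card_pos.2 ⟨m, hmem⟩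
    by_contra hlt
    have hlt' : |d m| < |d k| := lt_of_le_of_ne (hk m (by simp)) hlt
    have hs : ∑ m ∈ parents H a, |d m| < ∑ m ∈ parents H a, |d k| :=
      Finset.sum_lt_sum (fun b _ => hk b (by simp)) ⟨m, hmem, hlt'⟩
    have h3 : (parents H a).card * |d a| = |∑ m ∈ parents H a, d m| := by
      rw [h2 a hai hP, abs_mul, abs_of_pos (by positivity)]
      field_simp
    have h4 := Finset.abs_sum_le_sum_abs d (parents H a)
    rw [Finset.sum_const, nsmul_eq_mul] at hs
    rw [ha] at h3
    linarith
  obtain ⟨-, ⟨P⟩⟩ := key k rfl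
  have := back_closed H i (fun a => |d a| = |d k|) hcl P.steps P.chain
    (by rw [List.getLast_cons P.ne, P.last])
  rw [h0] at this
  rw [← this] at hD
  simp at hD

theorem fixed_vector_eq_effects (p : ℕ) (hp : 2 ≤ p) (H : Fin p → Fin p → Bool)
    (hdiag : ∀ i : Fin p, H i i = false) (i : Fin p) (v : Fin p → ℝ)
    (hv : (Mmat H i).mulVec v = v) (hvi : v i = 1) :
    ∀ j : Fin p, v j = effect H i j := by
  classical
  have hrow : ∀ k, k ≠ i → v k = if Nonempty (NetPath (edge H) i k) then
      1 / ((parents H k).card : ℝ) * ∑ m ∈ parents H k, v m else 0 := by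
    intro k hk
    have h := congrFun hv k
    rw [← h]
    simp only [Matrix.mulVec, dotProduct, Mmat, Matrix.of_apply, hk, if_false]
    split_ifs with hP
    · simp only [hP, true_and, ite_mul, zero_mul]
      rw [← Finset.sum_filter, Finset.mul_sum]
      have hf : Finset.univ.filter (fun m => m ∈ parents H k) = parents H k := by ext; simp
      rw [hf]
    · simp [hP]
  have hfin : ∀ k, ∑' L, gw H i L k ≠ ⊤ := fun k =>
    ne_top_of_le_ne_top ENNReal.one_ne_top (gw_le_one H i k)
  have hmax := max_principle H i (fun k => v k - (∑' L, gw H i L k).toReal)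
    (by simp [hvi, gw_tsum_self])
    (by
      intro k hk hP
      have hz : ∀ L, gw H i L k = 0 := by
        intro L
        by_contra h
        obtain ⟨P, -⟩ := gw_support H i k hk L h
        exact hP ⟨P⟩
      simp [hz, hrow k hk, hP])
    (by
      intro k hk hP
      rw [hrow k hk, if_pos hP, gw_tsum_rec H i k hk, ENNReal.toReal_mul,
        ENNReal.toReal_ofReal (by positivity), ENNReal.toReal_sum (fun m _ => hfin m),
        Finset.sum_sub_distrib, mul_sub])
  intro j
  rw [← gw_effect]
  exact sub_eq_zero.1 (hmax j)
end

section
/- For every unweighted network H on V and every vertex i ∈ V: if every vertex j ≠ i is reachable from i (that is, H(i→j) ≠ ∅ for all j ∈ V with j ≠ i), then e_ij = 1 for all j ∈ V. -/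
open scoped ENNReal

/-- Indicator of an edge. -/
noncomputable def hh {p : ℕ} (H : Fin p → Fin p → Bool) (k j : Fin p) : ℝ≥0∞ :=
  if H k j = true then 1 else 0

/-- The step coefficient. -/
noncomputable def aa {p : ℕ} (H : Fin p → Fin p → Bool) (i j : Fin p) : ℝ≥0∞ :=
  if j = i then 0 else ((parents H j).card : ℝ≥0∞)⁻¹

/-- Weight of the reversed path `j :: l` (or zero if it is not a path). -/
noncomputable def cc {p : ℕ} (H : Fin p → Fin p → Bool) (i : Fin p) :
    List (Fin p) → Fin p → ℝ≥0∞
  | [], j => aa H i j * hh H i j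
  | k :: l, j => aa H i j * (hh H k j * cc H i l k)

/-- Weighted total. -/
noncomputable def KK {p : ℕ} (H : Fin p → Fin p → Bool) (i : Fin p) (φ : ℕ → ℝ≥0∞)
    (j : Fin p) : ℝ≥0∞ := ∑' l : List (Fin p), φ l.length * cc H i l j

/-- Lists are either empty or a cons. -/
def listE (α : Type) : Unit ⊕ (α × List α) ≃ List α where
  toFun o := match o with
    | .inl _ => []
    | .inr (a, l) => a :: l
  invFun l := match l with
    | [] => .inl ()
    | a :: l => .inr (a, l)
  left_inv o := by rcases o with _ | ⟨a, l⟩ <;> rfl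
  right_inv l := by cases l <;> rfl

theorem KK_rec {p : ℕ} (H : Fin p → Fin p → Bool) (i : Fin p) (φ : ℕ → ℝ≥0∞) (j : Fin p) :
    KK H i φ j = aa H i j * (φ 0 * hh H i j
      + ∑ k, hh H k j * KK H i (fun n => φ (n + 1)) k) := by
  unfold KK
  rw [← (listE (Fin p)).tsum_eq, Summable.tsum_sum ENNReal.summable ENNReal.summable, ENNReal.summable.tsum_prod' (fun _ => ENNReal.summable), tsum_fintype,
    tsum_fintype, Fintype.sum_unique]
  simp only [listE, Equiv.coe_fn_mk, cc, List.length_nil, List.length_cons]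
  rw [mul_add, Finset.mul_sum]
  congr 1
  · ring
  · refine Finset.sum_congr rfl fun k _ => ?_
    rw [← ENNReal.tsum_mul_left, ← ENNReal.tsum_mul_left]
    refine tsum_congr fun l => ?_
    ring

theorem KK_self {p : ℕ} (H : Fin p → Fin p → Bool) (i : Fin p) (φ : ℕ → ℝ≥0∞) :
    KK H i φ i = 0 := by
  rw [KK_rec]; simp [aa]

theorem sum_hh {p : ℕ} (H : Fin p → Fin p → Bool) (j : Fin p) :
    ∑ k, hh H k j = ((parents H j).card : ℝ≥0∞) := by
  simp [hh, parents, Finset.sum_boole]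

theorem KK_trunc {p : ℕ} (H : Fin p → Fin p → Bool) (i : Fin p) (n : ℕ) :
    ∀ j, KK H i (fun m => if m < n then 1 else 0) j ≤ 1 := by
  induction n with
  | zero => intro j; simp [KK]
  | succ n ih =>
    intro j
    rw [KK_rec]
    have h1 : (if 0 < n + 1 then (1 : ℝ≥0∞) else 0) * hh H i j
      + ∑ k, hh H k j * KK H i (fun m => if m + 1 < n + 1 then 1 else 0) k
        ≤ ((parents H j).card : ℝ≥0∞) := by
      rw [← sum_hh, ← Finset.add_sum_erase _ _ (Finset.mem_univ i), KK_self,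
        ← Finset.add_sum_erase _ (fun k => hh H k j) (Finset.mem_univ i)]
      simp only [Nat.succ_pos, if_true, one_mul, mul_zero, zero_add, Nat.add_lt_add_iff_right]
      gcongr with k hk
      calc _ ≤ hh H k j * 1 := by gcongr; exact ih k
        _ = _ := mul_one _
    refine (mul_le_mul_right h1 _).trans ?_
    unfold aa
    split_ifs
    · simp
    · rw [mul_comm]; exact ENNReal.mul_inv_le_one _

theorem KK_le {p : ℕ} (H : Fin p → Fin p → Bool) (i j : Fin p) :
    KK H i (fun _ => 1) j ≤ 1 := by
  unfold KK
  rw [ENNReal.tsum_eq_iSup_sum]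
  refine iSup_le fun s => ?_
  refine le_trans ?_ (KK_trunc H i (s.sup List.length + 1) j)
  refine le_trans ?_ (ENNReal.sum_le_tsum s)
  refine Finset.sum_le_sum fun l hl => ?_
  have : l.length < s.sup List.length + 1 := Nat.lt_succ_of_le (Finset.le_sup hl)
  simp [this]

/-- Reversed lists which give a path. -/
def good {p : ℕ} (H : Fin p → Fin p → Bool) (i j : Fin p) (l : List (Fin p)) : Prop :=
  List.IsChain (edge H) (i :: (l.reverse ++ [j])) ∧ ∀ v ∈ l.reverse ++ [j], v ≠ i

theorem good_cons {p : ℕ} (H : Fin p → Fin p → Bool) (i j k : Fin p) (l : List (Fin p)) :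
    good H i j (k :: l) ↔ good H i k l ∧ H k j = true ∧ j ≠ i := by
  have : i :: ((k :: l).reverse ++ [j]) = (i :: (l.reverse ++ [k])) ++ [j] := by simp
  unfold good
  rw [this, List.isChain_append]
  have e : (i :: (l.reverse ++ [k])).getLast? = some k := by
    rw [← List.cons_append, List.getLast?_append]; rfl
  rw [e]
  simp [edge, or_imp, forall_and]
  tauto

open Classical in
theorem cc_eq {p : ℕ} (H : Fin p → Fin p → Bool) (i : Fin p) (l : List (Fin p)) :
    ∀ j, (cc H i l j).toReal = if good H i j l then
      ((l.reverse ++ [j]).map fun v => (1 : ℝ) / ((parents H v).card : ℝ)).prod else 0 := by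
  induction l with
  | nil =>
    intro j
    by_cases h1 : j = i <;> by_cases h2 : H i j = true <;>
      simp [cc, aa, hh, good, edge, h1, h2]
  | cons k l ih =>
    intro j
    rw [cc, ENNReal.toReal_mul, ENNReal.toReal_mul, ih]
    simp only [good_cons]
    by_cases h1 : j = i <;> by_cases h2 : H k j = true <;> by_cases h3 : good H i k l <;>
      simp [aa, hh, h1, h2, h3]
    ring

/-- Paths correspond to good lists. -/
noncomputable def pathE {p : ℕ} (H : Fin p → Fin p → Bool) (i j : Fin p) :
    {l // good H i j l} ≃ NetPath (edge H) i j where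
  toFun l := ⟨l.1.reverse ++ [j], by simp, l.2.1, by simp, l.2.2⟩
  invFun P := ⟨P.steps.dropLast.reverse, by
    have : P.steps.dropLast.reverse.reverse ++ [j] = P.steps := by
      rw [List.reverse_reverse]
      have := List.dropLast_append_getLast P.ne
      rwa [P.last] at this
    unfold good
    rw [this]
    exact ⟨P.chain, P.avoid⟩⟩
  left_inv l := by simp
  right_inv P := by
    rcases P with ⟨s, h1, h2, h3, h4⟩
    have := List.dropLast_append_getLast h1
    rw [h3] at this
    simp [this]

theorem tsum_path {p : ℕ} (H : Fin p → Fin p → Bool) (i j : Fin p) :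
    ∑' P : NetPath (edge H) i j, pweight H P = (KK H i (fun _ => 1) j).toReal := by
  classical
  have hne : ∀ l, cc H i l j ≠ ∞ := by
    intro l
    refine ne_top_of_le_ne_top ENNReal.one_ne_top (le_trans ?_ (KK_le H i j))
    have := ENNReal.le_tsum (f := fun l : List (Fin p) => (1 : ℝ≥0∞) * cc H i l j) l
    simpa [KK] using this
  unfold KK
  simp only [one_mul]
  rw [ENNReal.tsum_toReal_eq hne, ← (pathE H i j).tsum_eq]
  simp only [cc_eq]
  exact (tsum_subtype {l | good H i j l} (fun l => ((l.reverse ++ [j]).map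
    fun v => (1 : ℝ) / ((parents H v).card : ℝ)).prod)).trans
    (tsum_congr fun l => by simp [Set.indicator_apply])

theorem effect_harm {p : ℕ} (H : Fin p → Fin p → Bool) (i j : Fin p) (hj : j ≠ i)
    (hd : (parents H j).Nonempty) :
    ((parents H j).card : ℝ) * effect H i j = ∑ k ∈ parents H j, effect H i k := by
  have hd' : ((parents H j).card : ℝ) ≠ 0 := by
    exact_mod_cast hd.card_pos.ne'
  have hfin : ∀ k, KK H i (fun _ => 1) k ≠ ∞ := fun k =>
    ne_top_of_le_ne_top ENNReal.one_ne_top (KK_le H i k)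
  have hhfin : ∀ k, hh H k j ≠ ∞ := by intro k; unfold hh; split_ifs <;> simp
  simp only [effect, tsum_path, Ne.symm hj, if_false, zero_add]
  rw [KK_rec, ENNReal.toReal_mul, ENNReal.toReal_add (by simp [hhfin])
    (ENNReal.sum_ne_top.2 fun k _ => ENNReal.mul_ne_top (hhfin k) (hfin k)),
    ENNReal.toReal_sum fun k _ => ENNReal.mul_ne_top (hhfin k) (hfin k)]
  simp only [aa, hj, if_false, ENNReal.toReal_inv, ENNReal.toReal_natCast, one_mul]
  rw [mul_inv_cancel_left₀ hd', Finset.sum_add_distrib]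
  congr 1
  · simp [hh, parents, apply_ite]
  · simp [hh, parents, Finset.sum_filter, apply_ite, ite_mul]

theorem back {p : ℕ} (H : Fin p → Fin p → Bool) (i : Fin p) (S : Fin p → Prop)
    (hS : ∀ j k, j ≠ i → S j → H k j = true → S k) (l : List (Fin p)) :
    ∀ a, List.IsChain (edge H) (a :: l) → (∀ v ∈ l, v ≠ i) →
      S ((a :: l).getLast (by simp)) → S a := by
  induction l with
  | nil => intro a _ _ h; simpa using h
  | cons b l ih =>
    intro a hc hv h
    rw [List.isChain_cons_cons] at hc
    rw [List.getLast_cons (by simp)] at h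
    exact hS b a (hv b (by simp)) (ih b hc.2 (fun v hv' => hv v (by simp [hv'])) h) hc.1

theorem effect_eq_one_of_all_reachable (p : ℕ) (hp : 2 ≤ p)
    (H : Fin p → Fin p → Bool) (hdiag : ∀ i : Fin p, H i i = false) (i : Fin p)
    (h : ∀ j : Fin p, j ≠ i → Nonempty (NetPath (edge H) i j)) :
    ∀ j : Fin p, effect H i j = 1 := by
  have hi : effect H i i = 1 := by simp [effect, tsum_path, KK_self]
  have hle : ∀ j, effect H i j ≤ 1 := by
    intro j
    by_cases hj : i = j
    · subst hj; exact hi.le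
    · simp only [effect, tsum_path, hj, if_false, zero_add]
      exact ENNReal.toReal_le_of_le_ofReal zero_le_one (by simpa using KK_le H i j)
  obtain ⟨m, -, hm⟩ := Finset.exists_min_image Finset.univ (effect H i) ⟨i, Finset.mem_univ i⟩
  have hS : ∀ j k, j ≠ i → effect H i j = effect H i m → H k j = true →
      effect H i k = effect H i m := by
    intro j k hj hjm hk
    have hk' : k ∈ parents H j := by simp [parents, hk]
    have e := effect_harm H i j hj ⟨k, hk'⟩
    rw [hjm, ← nsmul_eq_mul, ← Finset.sum_const] at e
    exact ((Finset.sum_eq_sum_iff_of_le fun x _ => hm x (Finset.mem_univ x)).1 e k hk').symm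
  have key : effect H i i = effect H i m := by
    by_cases hmi : m = i
    · rw [hmi]
    · obtain ⟨P⟩ := h m hmi
      refine back H i (fun x => effect H i x = effect H i m) hS P.steps i P.chain P.avoid ?_
      rw [List.getLast_cons P.ne, P.last]
  intro j
  have := hm j (Finset.mem_univ j)
  linarith [hle j]
end

section
/- Suppose p ≥ 3 and let G be the unweighted network on V with edge set {(1,i) : 2 ≤ i ≤ p−1} ∪ {(i,p) : 2 ≤ i ≤ p−1}, and no other edges. Then the effects of G are given by: e_kk = 1 for all k ∈ V; e_1j = 1 for all j ∈ V; e_kp = 1/(p−2) for all 2 ≤ k ≤ p−1; and e_ij = 0 for all remaining pairs (i,j). -/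
/-- The network `G` on `V = {1,…,p}` (0-indexed here, vertex `1 ↦ 0`, vertex `p ↦ p−1`)
with edges `{(1,i) : 2 ≤ i ≤ p−1} ∪ {(i,p) : 2 ≤ i ≤ p−1}` and no other edges. -/
def hubNet0 (p : ℕ) : Fin p → Fin p → Bool :=
  fun a b =>
    decide ((a.val = 0 ∧ 1 ≤ b.val ∧ b.val ≤ p - 2) ∨
      (1 ≤ a.val ∧ a.val ≤ p - 2 ∧ b.val = p - 1))

theorem hub_edge_iff {p : ℕ} (a b : Fin p) : edge (hubNet0 p) a b ↔
    ((a.val = 0 ∧ 1 ≤ b.val ∧ b.val ≤ p - 2) ∨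
      (1 ≤ a.val ∧ a.val ≤ p - 2 ∧ b.val = p - 1)) := by
  simp [edge, hubNet0]

theorem NetPath.ext_steps {p : ℕ} {E : Fin p → Fin p → Prop} {i j : Fin p}
    (P Q : NetPath E i j) (h : P.steps = Q.steps) : P = Q := by
  cases P; cases Q; simp at h; subst h; rfl

theorem hub_cases {p : ℕ} (hp : 3 ≤ p) {i j : Fin p} (P : NetPath (edge (hubNet0 p)) i j) :
    (P.steps = [j] ∧ edge (hubNet0 p) i j) ∨
    (∃ a : Fin p, P.steps = [a, j] ∧ i.val = 0 ∧ 1 ≤ a.val ∧ a.val ≤ p - 2 ∧ j.val = p - 1) := by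
  obtain ⟨l, hne, hc, hl, ha⟩ := P
  match l, hne, hc, hl with
  | [a], _, hc, hl =>
    left
    simp at hl
    subst hl
    simpa [List.Chain] using hc
  | [a, b], _, hc, hl =>
    right
    simp at hl
    subst hl
    simp [List.Chain, hub_edge_iff] at hc
    exact ⟨a, rfl, by omega⟩
  | a :: b :: c :: t, _, hc, hl =>
    exfalso
    simp [List.Chain, hub_edge_iff] at hc
    omega

theorem hub_parents_mid {p : ℕ} (hp : 3 ≤ p) (k : Fin p) (h1 : 1 ≤ k.val) (h2 : k.val ≤ p - 2) :
    (parents (hubNet0 p) k).card = 1 := by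
  rw [Finset.card_eq_one]
  refine ⟨⟨0, by omega⟩, ?_⟩
  ext a
  have := hub_edge_iff a k
  simp only [edge] at this
  simp only [parents, Finset.mem_filter, Finset.mem_univ, true_and, Finset.mem_singleton, this,
    Fin.ext_iff]
  omega

theorem hub_mem_parents {p : ℕ} (hp : 3 ≤ p) (j a : Fin p) (h : j.val = p - 1) :
    a ∈ parents (hubNet0 p) j ↔ 1 ≤ a.val ∧ a.val ≤ p - 2 := by
  have := hub_edge_iff a j
  simp only [edge] at this
  simp only [parents, Finset.mem_filter, Finset.mem_univ, true_and, this]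
  omega

theorem hub_parents_last {p : ℕ} (hp : 3 ≤ p) (j : Fin p) (h : j.val = p - 1) :
    (parents (hubNet0 p) j).card = p - 2 := by
  have : (parents (hubNet0 p) j).map Fin.valEmbedding = Finset.Icc 1 (p - 2) := by
    ext a
    simp only [Finset.mem_map, hub_mem_parents hp j _ h, Fin.valEmbedding_apply, Finset.mem_Icc]
    constructor
    · rintro ⟨b, hb, rfl⟩; exact hb
    · intro ha; exact ⟨⟨a, by omega⟩, ha, rfl⟩
  rw [← Finset.card_map Fin.valEmbedding, this]
  simp

theorem hub_tsum_empty {p : ℕ} (hp : 3 ≤ p) (i j : Fin p) (h : ¬ edge (hubNet0 p) i j)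
    (h' : ¬ (i.val = 0 ∧ j.val = p - 1)) :
    ∑' P : NetPath (edge (hubNet0 p)) i j, pweight (hubNet0 p) P = 0 := by
  have : IsEmpty (NetPath (edge (hubNet0 p)) i j) := by
    refine ⟨fun P => ?_⟩
    rcases hub_cases hp P with ⟨_, h1⟩ | ⟨a, _, h1⟩
    · exact h h1
    · exact h' ⟨h1.1, h1.2.2.2⟩
  exact tsum_empty

theorem hub_tsum_edge {p : ℕ} (hp : 3 ≤ p) (i j : Fin p) (h : edge (hubNet0 p) i j) :
    ∑' P : NetPath (edge (hubNet0 p)) i j, pweight (hubNet0 p) P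
      = 1 / ((parents (hubNet0 p) j).card : ℝ) := by
  have h0 := (hub_edge_iff i j).1 h
  let P0 : NetPath (edge (hubNet0 p)) i j :=
    ⟨[j], by simp, by simpa [List.Chain] using h, by simp, by
      intro v hv
      simp at hv
      subst hv
      intro e
      subst e
      omega⟩
  have hu : ∀ P : NetPath (edge (hubNet0 p)) i j, P = P0 := by
    intro P
    apply NetPath.ext_steps
    rcases hub_cases hp P with ⟨h1, _⟩ | ⟨a, _, h1⟩
    · exact h1
    · omega
  rw [tsum_eq_single P0 (fun P hP => absurd (hu P) hP)]
  simp [pweight, P0]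

theorem hub_tsum_far {p : ℕ} (hp : 3 ≤ p) (i j : Fin p) (hi : i.val = 0) (hj : j.val = p - 1) :
    ∑' P : NetPath (edge (hubNet0 p)) i j, pweight (hubNet0 p) P = 1 := by
  let f : {a // a ∈ parents (hubNet0 p) j} → NetPath (edge (hubNet0 p)) i j := fun a =>
    ⟨[a.1, j], by simp, by
      have := (hub_mem_parents hp j a.1 hj).1 a.2
      simp [List.Chain, hub_edge_iff]
      omega, by simp, by
      have := (hub_mem_parents hp j a.1 hj).1 a.2
      intro v hv
      simp at hv
      intro e
      subst e
      rcases hv with hv | hv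
      · rw [← hv] at this; omega
      · rw [← hv] at hj; omega⟩
  have hf : Function.Bijective f := by
    constructor
    · intro a b hab
      have := congrArg NetPath.steps hab
      simp [f] at this
      exact this
    · intro P
      rcases hub_cases hp P with ⟨_, h1⟩ | ⟨a, h1, h2⟩
      · rw [hub_edge_iff] at h1; omega
      · exact ⟨⟨a, (hub_mem_parents hp j a hj).2 ⟨h2.2.1, h2.2.2.1⟩⟩,
          NetPath.ext_steps _ _ h1.symm⟩
  rw [← (Equiv.ofBijective f hf).tsum_eq, tsum_fintype]
  have hw : ∀ a, pweight (hubNet0 p) (Equiv.ofBijective f hf a)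
      = 1 / ((parents (hubNet0 p) j).card : ℝ) := by
    intro a
    have := (hub_mem_parents hp j a.1 hj).1 a.2
    simp [pweight, f, hub_parents_mid hp a.1 this.1 this.2]
  rw [Finset.sum_congr rfl (fun a _ => hw a)]
  have hc : ((parents (hubNet0 p) j).card : ℝ) ≠ 0 := by
    rw [hub_parents_last hp j hj]
    exact_mod_cast (by omega : p - 2 ≠ 0)
  simp [hc]

theorem hubNet0_effects (p : ℕ) (hp : 3 ≤ p) :
    (∀ k : Fin p, effect (hubNet0 p) k k = 1) ∧
      (∀ j : Fin p, effect (hubNet0 p) (⟨0, by omega⟩ : Fin p) j = 1) ∧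
      (∀ k : Fin p, 1 ≤ k.val → k.val ≤ p - 2 →
        effect (hubNet0 p) k (⟨p - 1, by omega⟩ : Fin p) = 1 / ((p : ℝ) - 2)) ∧
      (∀ i j : Fin p, i ≠ j → i.val ≠ 0 →
        ¬(1 ≤ i.val ∧ i.val ≤ p - 2 ∧ j.val = p - 1) →
        effect (hubNet0 p) i j = 0) := by
  refine ⟨fun k => ?_, fun j => ?_, fun k h1 h2 => ?_, fun i j hij hi h => ?_⟩
  · rw [effect, hub_tsum_empty hp k k (by rw [hub_edge_iff]; omega) (by omega)]
    simp
  · by_cases h0 : j.val = 0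
    · have he : (⟨0, by omega⟩ : Fin p) = j := Fin.ext h0.symm
      rw [effect, hub_tsum_empty hp _ _ (by rw [hub_edge_iff]; omega) (by omega), if_pos he,
        add_zero]
    · have hne : ¬ ((⟨0, by omega⟩ : Fin p) = j) := fun e => h0 (by rw [← e])
      rw [effect, if_neg hne, zero_add]
      by_cases hl : j.val = p - 1
      · exact hub_tsum_far hp _ j rfl hl
      · rw [hub_tsum_edge hp _ j (by rw [hub_edge_iff]; left; exact ⟨rfl, by omega, by omega⟩),
          hub_parents_mid hp j (by omega) (by omega)]
        simp
  · have hne : ¬ (k = (⟨p - 1, by omega⟩ : Fin p)) := fun e => by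
      have := congrArg Fin.val e
      simp at this
      omega
    rw [effect, if_neg hne, zero_add, hub_tsum_edge hp _ _
      (by rw [hub_edge_iff]; right; exact ⟨h1, h2, rfl⟩), hub_parents_last hp _ rfl,
      Nat.cast_sub (by omega)]
    simp
  · rw [effect, if_neg hij, zero_add,
      hub_tsum_empty hp i j (by rw [hub_edge_iff]; omega) (by omega)]
end

section
/- For every weighted network H on V and every vertex i ∈ V, the diagonal output of the generalised Warshall recursion identifies the largest threshold at which i lies on a cycle: τ^(p)_{i,i} equals the maximum, over all sequences of vertices (q_0, q_1, …, q_m) with m ≥ 2, q_0 = q_m = i, and q_l ≠ i for 1 ≤ l ≤ m−1, of the bottleneck value min_{1 ≤ l ≤ m} H(q_{l−1}, q_l). -/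
/-- The generalised Warshall recursion: `warshall H 0 = H` (as `τ^(0)`), and
`τ^(k)_{i,j} = max(τ^(k−1)_{i,j}, min(τ^(k−1)_{i,k}, τ^(k−1)_{k,j}))` for `1 ≤ k ≤ p`,
where the 1-indexed vertex `k` is the 0-indexed vertex `⟨k−1, _⟩` of `Fin p`. -/
noncomputable def warshall {p : ℕ} (H : Fin p → Fin p → ℝ) : ℕ → Fin p → Fin p → ℝ
  | 0 => H
  | k + 1 => fun i j =>
      if hk : k < p then
        max (warshall H k i j)
          (min (warshall H k i ⟨k, hk⟩) (warshall H k ⟨k, hk⟩ j))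
      else warshall H k i j

/-- Bottleneck value of the vertex sequence `(u, v₁, …, vₘ)` (given as `u` and the
nonempty list `[v₁, …, vₘ]`): the minimum of the weights of consecutive pairs
`min_{1 ≤ l ≤ m} H(p_{l−1}, p_l)`. (Value `1` on the empty list, which is unused.) -/
noncomputable def bottleneck {p : ℕ} (H : Fin p → Fin p → ℝ) :
    Fin p → List (Fin p) → ℝ
  | _, [] => 1
  | u, [v] => H u v
  | u, v :: w :: l => min (H u v) (bottleneck H v (w :: l))

theorem warshall_trans {p : ℕ} (H : Fin p → Fin p → ℝ) (t : ℝ) (k : ℕ) :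
    ∀ (i m j : Fin p), m.val < k → t ≤ warshall H k i m → t ≤ warshall H k m j →
      t ≤ warshall H k i j := by
  induction k with
  | zero => intro i m j h; omega
  | succ k ih =>
    intro i m j hm h1 h2
    by_cases hk : k < p
    · simp only [warshall, hk, dif_pos, le_max_iff, le_min_iff] at h1 h2 ⊢
      rcases Nat.lt_succ_iff_lt_or_eq.mp hm with h | h
      · have a := ih i m j h
        have b := ih i m ⟨k, hk⟩ h
        have c := ih ⟨k, hk⟩ m j h
        tauto
      · have : m = ⟨k, hk⟩ := Fin.ext h
        subst this
        tauto
    · simp only [warshall, hk, dif_neg, not_false_eq_true] at h1 h2 ⊢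
      exact ih i m j (by have := m.isLt; omega) h1 h2

theorem le_warshall {p : ℕ} (H : Fin p → Fin p → ℝ) (k : ℕ) (i j : Fin p) :
    H i j ≤ warshall H k i j := by
  induction k with
  | zero => exact le_refl _
  | succ k ih =>
    by_cases hk : k < p
    · simp only [warshall, hk, dif_pos, le_max_iff]
      exact Or.inl ih
    · simpa only [warshall, hk, dif_neg, not_false_eq_true] using ih

theorem transGen_of_le_warshall {p : ℕ} (H : Fin p → Fin p → ℝ) (t : ℝ) (k : ℕ) :
    ∀ (i j : Fin p), t ≤ warshall H k i j →
      Relation.TransGen (fun u v => t ≤ H u v) i j := by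
  induction k with
  | zero => intro i j h; exact Relation.TransGen.single h
  | succ k ih =>
    intro i j h
    by_cases hk : k < p
    · simp only [warshall, hk, dif_pos, le_max_iff, le_min_iff] at h
      rcases h with h | ⟨h1, h2⟩
      · exact ih i j h
      · exact (ih _ _ h1).trans (ih _ _ h2)
    · simp only [warshall, hk, dif_neg, not_false_eq_true] at h
      exact ih i j h

theorem bottleneck_le_warshall {p : ℕ} (H : Fin p → Fin p → ℝ) (L : List (Fin p)) :
    ∀ (u : Fin p) (hL : L ≠ []), bottleneck H u L ≤ warshall H p u (L.getLast hL) := by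
  induction L with
  | nil => intro u h; exact absurd rfl h
  | cons v l ih =>
    intro u hL
    cases l with
    | nil => simpa [bottleneck] using le_warshall H p u v
    | cons w l =>
      have h := ih v (by simp)
      rw [List.getLast_cons (by simp)]
      simp only [bottleneck]
      refine warshall_trans H _ p u v _ v.isLt ?_ ?_
      · exact (min_le_left _ _).trans (le_warshall H p u v)
      · exact (min_le_right _ _).trans h

theorem exists_list_of_transGen {p : ℕ} (H : Fin p → Fin p → ℝ) (t : ℝ) (u i : Fin p)
    (h : Relation.TransGen (fun u v => t ≤ H u v) u i) :
    ∃ (L : List (Fin p)) (hL : L ≠ []), L.getLast hL = i ∧ (∀ v ∈ L.dropLast, v ≠ i) ∧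
      t ≤ bottleneck H u L := by
  induction h using Relation.TransGen.head_induction_on with
  | single h => exact ⟨[i], by simp, by simp, by simp, by simpa [bottleneck] using h⟩
  | @head a c h _ ih =>
    by_cases hc : c = i
    · subst hc
      exact ⟨[c], by simp, by simp, by simp, by simpa [bottleneck] using h⟩
    · obtain ⟨L, hL, h1, h2, h3⟩ := ih
      obtain ⟨w, l, rfl⟩ := List.exists_cons_of_ne_nil hL
      refine ⟨c :: w :: l, by simp, ?_, ?_, ?_⟩
      · rw [List.getLast_cons (by simp)]; exact h1
      · intro v hv
        rw [List.dropLast_cons_of_ne_nil (by simp), List.mem_cons] at hv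
        rcases hv with rfl | hv
        · exact hc
        · exact h2 v hv
      · simp only [bottleneck]
        exact le_min h h3

theorem warshall_diagonal_max_cycle_bottleneck (p : ℕ) (hp : 2 ≤ p)
    (H : Fin p → Fin p → ℝ) (h01 : ∀ u v : Fin p, 0 ≤ H u v ∧ H u v ≤ 1)
    (hdiag : ∀ u : Fin p, H u u = 0) (i : Fin p) :
    IsGreatest {x : ℝ | ∃ (L : List (Fin p)) (hL : L ≠ []),
        2 ≤ L.length ∧ L.getLast hL = i ∧ (∀ v ∈ L.dropLast, v ≠ i) ∧
        x = bottleneck H i L}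
      (warshall H p i i) := by
  have key : ∀ (L : List (Fin p)) (hL : L ≠ []), L.getLast hL = i →
      bottleneck H i L ≤ warshall H p i i := by
    intro L hL h
    have := bottleneck_le_warshall H L i hL
    rwa [h] at this
  constructor
  · rcases le_or_gt (warshall H p i i) 0 with h0 | h0
    · haveI : Nontrivial (Fin p) := Fin.nontrivial_iff_two_le.mpr hp
      obtain ⟨j, hj⟩ := exists_ne i
      refine ⟨[j, i], by simp, by simp, by simp, by simpa using hj,
        le_antisymm (h0.trans ?_) (key _ (by simp) (by simp))⟩
      simp only [bottleneck]
      exact le_min (h01 _ _).1 (h01 _ _).1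
    · obtain ⟨L, hL, h1, h2, h3⟩ := exists_list_of_transGen H _ i i
        (transGen_of_le_warshall H _ p i i le_rfl)
      refine ⟨L, hL, ?_, h1, h2, le_antisymm h3 (key L hL h1)⟩
      match L, hL, h1, h3 with
      | [v], _, h1, h3 =>
        simp only [List.getLast_singleton] at h1
        subst h1
        simp only [bottleneck, hdiag] at h3
        linarith
      | _ :: _ :: _, _, _, _ => simp
  · rintro x ⟨L, hL, _, h1, _, rfl⟩
    exact key L hL h1
end
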